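/- arXiv:2411.11815 — 14 statements merged into one kernel-verified Lean document; each statement's English description precedes it below -/
import Mathlib

section
/- Let m and n be positive integers, let z be a complex number, and let ε ∈ {1, -1}. Then Σ_{λ ∈ P(n)} Σ_{k≥1} ε^{k-1} k^z t_{km}(λ) = Σ_{λ ∈ P(n)} Σ_{k≥1} ε^{k-1} k^z ⌊t_k(λ)/m⌋, where both outer sums run over all partitions λ of n. (Taking ε = 1 gives the identity t_m + 2^z t_{2m} + 3^z t_{3m} + ⋯ and taking ε = -1 gives the alternating-sign version.) -/
/-- The number of partitions of `n` containing a given multiset of positive parts depends only on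
the sum of that multiset. -/
theorem Nat.Partition.card_filter_le_parts_eq {n : ℕ} {s t : Multiset ℕ}
    (hs : ∀ i ∈ s, 0 < i) (ht : ∀ i ∈ t, 0 < i) (hst : s.sum = t.sum) :
    (Finset.univ.filter fun p : Nat.Partition n => s ≤ p.parts).card
      = (Finset.univ.filter fun p : Nat.Partition n => t ≤ p.parts).card := by
  have parts_pos : ∀ (p : Nat.Partition n) {u v : Multiset ℕ}, (∀ i ∈ v, 0 < i) →
      ∀ {i}, i ∈ p.parts - u + v → 0 < i := by
    intro p u v hv i hi
    rcases Multiset.mem_add.1 hi with h | h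
    · exact p.parts_pos (Multiset.mem_of_le (Multiset.sub_le_self _ _) h)
    · exact hv i h
  have parts_sum : ∀ (p : Nat.Partition n) {u v : Multiset ℕ}, u.sum = v.sum → u ≤ p.parts →
      (p.parts - u + v).sum = n := by
    intro p u v huv hu
    rw [Multiset.sum_add, ← huv, ← Multiset.sum_add, Multiset.sub_add_cancel hu, p.parts_sum]
  refine Finset.card_bij'
    (fun p hp => ⟨p.parts - s + t, parts_pos p ht, parts_sum p hst (Finset.mem_filter.1 hp).2⟩)
    (fun p hp => ⟨p.parts - t + s, parts_pos p hs,
      parts_sum p hst.symm (Finset.mem_filter.1 hp).2⟩) ?_ ?_ ?_ ?_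
  · intro p hp
    simp
  · intro p hp
    simp
  · intro p hp
    ext1
    simp [Multiset.sub_add_cancel (Finset.mem_filter.1 hp).2]
  · intro p hp
    ext1
    simp [Multiset.sub_add_cancel (Finset.mem_filter.1 hp).2]

theorem Nat.card_filter_Icc_one_le {a n : ℕ} (h : a ≤ n) :
    ((Finset.Icc 1 n).filter fun j => j ≤ a).card = a := by
  have : (Finset.Icc 1 n).filter (fun j => j ≤ a) = Finset.Icc 1 a := by
    ext j
    simp only [Finset.mem_filter, Finset.mem_Icc]
    omega
  simp [this]

theorem Nat.Partition.count_parts_le {n : ℕ} (p : Nat.Partition n) (i : ℕ) :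
    p.parts.count i ≤ n := by
  refine (Multiset.count_le_card i p.parts).trans ?_
  have h := Multiset.card_nsmul_le_sum (s := p.parts) (a := 1) fun _ hx => p.parts_pos hx
  simpa [p.parts_sum] using h

/-- Over all partitions of `n`, the total multiplicity of the part `k * m` equals the total of the
multiplicities of `k` divided by `m` and rounded down. -/
theorem Nat.Partition.sum_count_mul_eq_sum_count_div {m k : ℕ} (n : ℕ) (hm : 0 < m) (hk : 0 < k) :
    ∑ p : Nat.Partition n, p.parts.count (k * m)
      = ∑ p : Nat.Partition n, p.parts.count k / m := by
  have layer : ∀ f : Nat.Partition n → ℕ, (∀ p, f p ≤ n) →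
      ∑ p, f p = ∑ j ∈ Finset.Icc 1 n, (Finset.univ.filter fun p => j ≤ f p).card := by
    intro f hf
    simp only [Finset.card_filter]
    rw [Finset.sum_comm]
    refine Finset.sum_congr rfl fun p _ => ?_
    rw [← Finset.card_filter, Nat.card_filter_Icc_one_le (hf p)]
  rw [layer _ fun p => p.count_parts_le _,
    layer _ fun p => (Nat.div_le_self _ _).trans (p.count_parts_le _)]
  refine Finset.sum_congr rfl fun j _ => ?_
  simp only [Nat.le_div_iff_mul_le hm, Multiset.le_count_iff_replicate_le]
  refine Nat.Partition.card_filter_le_parts_eq ?_ ?_ ?_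
  · intro i hi
    rw [Multiset.eq_of_mem_replicate hi]
    positivity
  · intro i hi
    rwa [Multiset.eq_of_mem_replicate hi]
  · simp only [Multiset.sum_replicate, smul_eq_mul]
    ring


/-- For positive integers `m`, `n`, a complex number `z`, and `ε ∈ {1, -1}`:
`Σ_{λ ∈ P(n)} Σ_{k≥1} ε^(k-1) k^z t_{km}(λ) = Σ_{λ ∈ P(n)} Σ_{k≥1} ε^(k-1) k^z ⌊t_k(λ)/m⌋`.
Since every part of a partition of `n` is at most `n`, the multiplicity `t_i(λ)` vanishes
for `i > n` and `t_i(λ) ≤ n`, so the inner sums may be taken over `1 ≤ k ≤ n`. -/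
theorem stmt_0 (m n : ℕ) (hm : 0 < m) (hn : 0 < n) (z : ℂ) (ε : ℂ)
    (hε : ε = 1 ∨ ε = -1) :
    ∑ p : Nat.Partition n, ∑ k ∈ Finset.Icc 1 n,
        ε ^ (k - 1) * (k : ℂ) ^ z * (p.parts.count (k * m) : ℂ)
      = ∑ p : Nat.Partition n, ∑ k ∈ Finset.Icc 1 n,
        ε ^ (k - 1) * (k : ℂ) ^ z * ((p.parts.count k / m : ℕ) : ℂ) := by
  rw [Finset.sum_comm, Finset.sum_comm (s := Finset.univ)]
  refine Finset.sum_congr rfl fun k hk => ?_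
  rw [← Finset.mul_sum, ← Finset.mul_sum, ← Nat.cast_sum, ← Nat.cast_sum,
    Nat.Partition.sum_count_mul_eq_sum_count_div n hm (Finset.mem_Icc.1 hk).1]
end

section
/- Let m and n be positive integers, let z be a complex number, and let ε ∈ {1, -1}. Then Σ_{λ ∈ P(n)} Σ_{k≥1} ε^{k-1} k^z t_{km}(λ) = Σ_{λ ∈ P(n)} Σ_{k≥1} ε^{k-1} k^z ⌊t_1(λ)/(km)⌋, where both outer sums run over all partitions λ of n. -/
/-- Exchange `d` ones for a part `d` as often as possible, and split every part `d` into ones. -/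
def exchangeParts (d : ℕ) (s : Multiset ℕ) : Multiset ℕ :=
  s.filter (fun i => i ≠ 1 ∧ i ≠ d) + Multiset.replicate (s.count 1 / d) d +
    Multiset.replicate (s.count d * d + s.count 1 % d) 1

theorem count_exchangeParts {d : ℕ} (hd : 1 < d) (s : Multiset ℕ) (i : ℕ) :
    (exchangeParts d s).count i =
      if i = 1 then s.count d * d + s.count 1 % d
      else if i = d then s.count 1 / d else s.count i := by
  simp only [exchangeParts, Multiset.count_add, Multiset.count_filter, Multiset.count_replicate]
  split_ifs <;> grind

theorem exchangeParts_involutive {d : ℕ} (hd : 1 < d) :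
    Function.Involutive (exchangeParts d) := by
  intro s
  ext i
  have h1 : (s.count d * d + s.count 1 % d) / d = s.count d := by
    rw [Nat.add_comm, Nat.add_mul_div_right _ _ (by omega),
      Nat.div_eq_of_lt (Nat.mod_lt _ (by omega)), Nat.zero_add]
  have h2 : (s.count d * d + s.count 1 % d) % d = s.count 1 % d := by simp
  have h3 := Nat.div_add_mod' (s.count 1) d
  simp only [count_exchangeParts hd, if_true, if_neg hd.ne', h1, h2, h3]
  split_ifs <;> simp_all

theorem sum_exchangeParts {d : ℕ} (hd : 1 < d) (s : Multiset ℕ) :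
    (exchangeParts d s).sum = s.sum := by
  have h : s = s.filter (fun i => i ≠ 1 ∧ i ≠ d) + Multiset.replicate (s.count d) d +
      Multiset.replicate (s.count 1) 1 := by
    ext i
    simp only [Multiset.count_add, Multiset.count_filter, Multiset.count_replicate]
    split_ifs <;> grind
  conv_rhs => rw [h]
  simp only [exchangeParts, Multiset.sum_add, Multiset.sum_replicate, smul_eq_mul, mul_one]
  have := Nat.div_add_mod' (s.count 1) d
  omega

/-- The involution of the partitions of `n` induced by `exchangeParts`. -/
def exchangePartition {d : ℕ} (hd : 1 < d) {n : ℕ} (p : Nat.Partition n) : Nat.Partition n where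
  parts := exchangeParts d p.parts
  parts_pos := by
    intro i hi
    simp only [exchangeParts, Multiset.mem_add, Multiset.mem_filter] at hi
    rcases hi with (hi | hi) | hi
    · exact p.parts_pos hi.1
    · have := Multiset.eq_of_mem_replicate hi
      omega
    · have := Multiset.eq_of_mem_replicate hi
      omega
  parts_sum := (sum_exchangeParts hd _).trans p.parts_sum

theorem exchangePartition_involutive {d : ℕ} (hd : 1 < d) (n : ℕ) :
    Function.Involutive (exchangePartition hd (n := n)) := fun p =>
  Nat.Partition.ext (exchangeParts_involutive hd p.parts)

theorem sum_count_eq_sum_count_one_div {d : ℕ} (hd : 0 < d) (n : ℕ) :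
    ∑ p : Nat.Partition n, p.parts.count d = ∑ p : Nat.Partition n, p.parts.count 1 / d := by
  obtain rfl | hd : d = 1 ∨ 1 < d := by omega
  · simp
  rw [← Equiv.sum_comp (exchangePartition_involutive hd n).toPerm]
  refine Finset.sum_congr rfl fun p _ => ?_
  change (exchangeParts d p.parts).count d = _
  rw [count_exchangeParts hd, if_neg hd.ne', if_pos rfl]

/-- For positive integers `m`, `n`, a complex number `z`, and `ε ∈ {1, -1}`:
`Σ_{λ ∈ P(n)} Σ_{k≥1} ε^(k-1) k^z t_{km}(λ) = Σ_{λ ∈ P(n)} Σ_{k≥1} ε^(k-1) k^z ⌊t_1(λ)/(km)⌋`.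
Since every part of a partition of `n` is at most `n` and `t_1(λ) ≤ n`, all terms with
`k > n` vanish, so the inner sums may be taken over `1 ≤ k ≤ n`. -/
theorem stmt_1 (m n : ℕ) (hm : 0 < m) (hn : 0 < n) (z : ℂ) (ε : ℂ)
    (hε : ε = 1 ∨ ε = -1) :
    ∑ p : Nat.Partition n, ∑ k ∈ Finset.Icc 1 n,
        ε ^ (k - 1) * (k : ℂ) ^ z * (p.parts.count (k * m) : ℂ)
      = ∑ p : Nat.Partition n, ∑ k ∈ Finset.Icc 1 n,
        ε ^ (k - 1) * (k : ℂ) ^ z * ((p.parts.count 1 / (k * m) : ℕ) : ℂ) := by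
  rw [Finset.sum_comm, Finset.sum_comm (s := Finset.univ)]
  refine Finset.sum_congr rfl fun k hk => ?_
  rw [← Finset.mul_sum, ← Finset.mul_sum, ← Nat.cast_sum, ← Nat.cast_sum,
    sum_count_eq_sum_count_one_div (Nat.mul_pos (Finset.mem_Icc.mp hk).1 hm)]
end

section
/- Let m and n be positive integers, let z be a complex number, and let ε ∈ {1, -1}. Then Σ_{λ ∈ P(n)} (-1)^{Σ_{k≥1} t_{km}(λ)} Σ_{k≥1} ε^{k-1} k^z t_{km}(λ) = Σ_{λ ∈ P(n)} (-1)^{Σ_{k≥1} ⌊t_k(λ)/m⌋} Σ_{k≥1} ε^{k-1} k^z ⌊t_k(λ)/m⌋, where both outer sums run over all partitions λ of n. -/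
open Finset in
/-- Partitions of `n` containing `t`, with complement satisfying `P`, correspond to partitions of
`n - t.sum` satisfying `P`. -/
theorem card_partition_filter_le {n : ℕ} (t : Multiset ℕ) (ht : 0 ∉ t) (hn : t.sum ≤ n)
    (P : Multiset ℕ → Prop) [DecidablePred P] :
    #{p : Nat.Partition n | t ≤ p.parts ∧ P (p.parts - t)} =
      #{r : Nat.Partition (n - t.sum) | P r.parts} := by
  symm
  refine Finset.card_bij' (fun r _ ↦ ⟨t + r.parts, ?_, ?_⟩) (fun p hp ↦ ⟨p.parts - t, ?_, ?_⟩)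
    ?_ ?_ ?_ ?_
  · intro i hi
    rcases Multiset.mem_add.1 hi with h | h
    · exact Nat.pos_of_ne_zero fun h0 ↦ ht (h0 ▸ h)
    · exact r.parts_pos h
  · rw [Multiset.sum_add, r.parts_sum]
    omega
  · intro i hi
    exact p.parts_pos (Multiset.mem_of_le (Multiset.sub_le_self _ _) hi)
  · have h := congrArg Multiset.sum (add_tsub_cancel_of_le (mem_filter.1 hp).2.1)
    rw [Multiset.sum_add, p.parts_sum] at h
    omega
  · intro r hr
    simpa using hr
  · intro p hp
    simpa using (mem_filter.1 hp).2.2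
  · intro r hr
    ext1
    simp
  · intro p hp
    ext1
    exact add_tsub_cancel_of_le (mem_filter.1 hp).2.1

theorem count_map_mul_right {m : ℕ} (hm : 0 < m) (q : Multiset ℕ) (k : ℕ) :
    (q.map (· * m)).count (k * m) = q.count k :=
  Multiset.count_map_eq_count' _ _ (fun _ _ h ↦ Nat.eq_of_mul_eq_mul_right hm h) _

theorem count_mul_eq_count_iff {m : ℕ} (hm : 0 < m) (p q : Multiset ℕ) :
    (fun k ↦ p.count (k * m)) = (fun k ↦ q.count k) ↔
      q.map (· * m) ≤ p ∧ ∀ i ∈ p - q.map (· * m), ¬ m ∣ i := by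
  constructor
  · intro h
    have h' (k : ℕ) : p.count (k * m) = q.count k := congrFun h k
    refine ⟨Multiset.le_iff_count.2 fun i ↦ ?_, ?_⟩
    · by_cases hi : i ∈ q.map (· * m)
      · obtain ⟨k, -, rfl⟩ := Multiset.mem_map.1 hi
        rw [count_map_mul_right hm, h']
      · simp [Multiset.count_eq_zero_of_notMem hi]
    · rintro i hi ⟨k, rfl⟩
      rw [← Multiset.count_pos, Multiset.count_sub, mul_comm m k, count_map_mul_right hm, h'] at hi
      omega
  · rintro ⟨hle, hP⟩
    funext k
    have h1 := Multiset.le_iff_count.1 hle (k * m)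
    have h2 : (p - q.map (· * m)).count (k * m) = 0 :=
      Multiset.count_eq_zero_of_notMem fun h ↦ hP _ h (Dvd.intro_left k rfl)
    rw [Multiset.count_sub] at h2
    rw [count_map_mul_right hm] at h1 h2
    omega

theorem count_div_eq_count_iff {m : ℕ} (hm : 0 < m) (p q : Multiset ℕ) :
    (fun k ↦ p.count k / m) = (fun k ↦ q.count k) ↔
      m • q ≤ p ∧ ∀ i ∈ p - m • q, (p - m • q).count i < m := by
  constructor
  · intro h
    have h' (k : ℕ) : p.count k / m = q.count k := congrFun h k
    refine ⟨Multiset.le_iff_count.2 fun i ↦ ?_, fun i _ ↦ ?_⟩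
    · rw [Multiset.count_nsmul, ← h']
      exact Nat.mul_div_le _ _
    · rw [Multiset.count_sub, Multiset.count_nsmul, ← h', ← Nat.mod_eq_sub_mul_div]
      exact Nat.mod_lt _ hm
  · rintro ⟨hle, hP⟩
    funext k
    have h1 := Multiset.le_iff_count.1 hle k
    have h2 : (p - m • q).count k < m := by
      by_cases hk : k ∈ p - m • q
      · exact hP k hk
      · rwa [Multiset.count_eq_zero_of_notMem hk]
    rw [Multiset.count_sub] at h2
    rw [Multiset.count_nsmul] at h1 h2
    rw [Nat.div_eq_iff hm, mul_comm]
    omega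

open Finset Classical in
/-- The multiplicities of the multiples of `m` and the quotients by `m` of the multiplicities are
equidistributed over the partitions of `n`. -/
theorem card_partition_count_mul_eq {m : ℕ} (hm : 0 < m) (n : ℕ) (g : ℕ → ℕ) :
    #{p : Nat.Partition n | (fun k ↦ p.parts.count (k * m)) = g} =
      #{p : Nat.Partition n | (fun k ↦ p.parts.count k / m) = g} := by
  have count_zero (p : Nat.Partition n) : p.parts.count 0 = 0 :=
    Multiset.count_eq_zero_of_notMem fun h ↦ (p.parts_pos h).false
  have count_large (p : Nat.Partition n) {k : ℕ} (hk : n < k) : p.parts.count k = 0 :=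
    Multiset.count_eq_zero_of_notMem fun h ↦ (p.le_of_mem_parts h).not_gt hk
  by_cases hg : g 0 = 0 ∧ ∀ k, n < k → g k = 0
  · obtain ⟨hg0, hgn⟩ := hg
    obtain ⟨q, rfl⟩ : ∃ q : Multiset ℕ, g = fun k ↦ q.count k := by
      refine ⟨∑ k ∈ range (n + 1), Multiset.replicate (g k) k, funext fun k ↦ ?_⟩
      simp only [Multiset.count_sum', Multiset.count_replicate, sum_ite_eq', mem_range]
      split_ifs with h
      · rfl
      · exact hgn k (by omega)
    have hq : 0 ∉ q := Multiset.count_eq_zero.1 hg0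
    have hs : (q.map (· * m)).sum = m * q.sum := by
      rw [Multiset.sum_map_mul_right, Multiset.map_id', mul_comm]
    have hs' : (m • q).sum = m * q.sum := by rw [Multiset.sum_nsmul, smul_eq_mul]
    simp only [count_mul_eq_count_iff hm, count_div_eq_count_iff hm]
    by_cases hle : m * q.sum ≤ n
    · rw [card_partition_filter_le (q.map (· * m)) (by simp [hm.ne', hq]) (hs ▸ hle)
          (fun r ↦ ∀ i ∈ r, ¬ m ∣ i),
        card_partition_filter_le (m • q) (fun h ↦ hq (Multiset.mem_of_mem_nsmul h)) (hs' ▸ hle)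
          (fun r ↦ ∀ i ∈ r, r.count i < m), hs, hs']
      exact Nat.Partition.card_restricted_eq_card_countRestricted _ hm
    · rw [filter_false_of_mem, filter_false_of_mem]
      · rintro p - ⟨h, -⟩
        have h_sum := congrArg Multiset.sum (add_tsub_cancel_of_le h)
        rw [Multiset.sum_add, p.parts_sum, hs'] at h_sum
        omega
      · rintro p - ⟨h, -⟩
        have h_sum := congrArg Multiset.sum (add_tsub_cancel_of_le h)
        rw [Multiset.sum_add, p.parts_sum, hs] at h_sum
        omega
  · rw [filter_false_of_mem, filter_false_of_mem]
    · rintro p - rfl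
      exact hg ⟨by simp [count_zero], fun k hk ↦ by simp [count_large p hk]⟩
    · rintro p - rfl
      exact hg ⟨by simp [count_zero], fun k hk ↦ count_large p (hk.trans_le
        (Nat.le_mul_of_pos_right k hm))⟩

/-- For positive integers `m`, `n`, a complex number `z`, and `ε ∈ {1, -1}`:
`Σ_{λ} (-1)^(Σ_k t_{km}(λ)) Σ_{k≥1} ε^(k-1) k^z t_{km}(λ)
  = Σ_{λ} (-1)^(Σ_k ⌊t_k(λ)/m⌋) Σ_{k≥1} ε^(k-1) k^z ⌊t_k(λ)/m⌋`.
All terms with `k > n` vanish, so sums may be taken over `1 ≤ k ≤ n`. -/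
theorem stmt_2 (m n : ℕ) (hm : 0 < m) (hn : 0 < n) (z : ℂ) (ε : ℂ)
    (hε : ε = 1 ∨ ε = -1) :
    ∑ p : Nat.Partition n,
        (-1 : ℂ) ^ (∑ k ∈ Finset.Icc 1 n, p.parts.count (k * m)) *
          ∑ k ∈ Finset.Icc 1 n,
            ε ^ (k - 1) * (k : ℂ) ^ z * (p.parts.count (k * m) : ℂ)
      = ∑ p : Nat.Partition n,
        (-1 : ℂ) ^ (∑ k ∈ Finset.Icc 1 n, p.parts.count k / m) *
          ∑ k ∈ Finset.Icc 1 n,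
            ε ^ (k - 1) * (k : ℂ) ^ z * ((p.parts.count k / m : ℕ) : ℂ) := by
  classical
  let F (g : ℕ → ℕ) : ℂ := (-1 : ℂ) ^ (∑ k ∈ Finset.Icc 1 n, g k) *
    ∑ k ∈ Finset.Icc 1 n, ε ^ (k - 1) * (k : ℂ) ^ z * (g k : ℂ)
  let A (p : Nat.Partition n) (k : ℕ) : ℕ := p.parts.count (k * m)
  let B (p : Nat.Partition n) (k : ℕ) : ℕ := p.parts.count k / m
  change ∑ p, F (A p) = ∑ p, F (B p)
  let S := Finset.univ.image A ∪ Finset.univ.image B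
  have hA (p) (_ : p ∈ Finset.univ) : A p ∈ S :=
    Finset.mem_union_left _ (Finset.mem_image_of_mem _ (Finset.mem_univ p))
  have hB (p) (_ : p ∈ Finset.univ) : B p ∈ S :=
    Finset.mem_union_right _ (Finset.mem_image_of_mem _ (Finset.mem_univ p))
  rw [← Finset.sum_fiberwise_of_maps_to' hA F, ← Finset.sum_fiberwise_of_maps_to' hB F]
  refine Finset.sum_congr rfl fun g _ ↦ ?_
  rw [Finset.sum_const, Finset.sum_const]
  congr 1
  convert card_partition_count_mul_eq hm n g
end

section
/- Let m and n be positive integers and let ε ∈ {1, -1}. Then Σ_{λ ∈ P(n)} ε^{t_m(λ)+t_{2m}(λ)+t_{3m}(λ)+⋯} (t_m(λ) + 2 t_{2m}(λ) + 3 t_{3m}(λ) + ⋯) = Σ_{λ ∈ P(n)} ε^{⌊t_1(λ)/m⌋+⌊t_2(λ)/m⌋+⋯+⌊t_n(λ)/m⌋} (⌊t_1(λ)/m⌋ + 2⌊t_2(λ)/m⌋ + ⋯ + n⌊t_n(λ)/m⌋), where both sums run over all partitions λ of n. -/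
/-- Partitions of `n` containing a multiset `D` of positive parts correspond to partitions of
`n - D.sum`. -/
theorem Nat.Partition.card_filter_le_and_sub (n : ℕ) (D : Multiset ℕ) (P : Multiset ℕ → Prop)
    [DecidablePred P] :
    (Finset.univ.filter fun p : n.Partition => D ≤ p.parts ∧ P (p.parts - D)).card =
      if 0 ∉ D ∧ D.sum ≤ n then
        (Finset.univ.filter fun q : (n - D.sum).Partition => P q.parts).card
      else 0 := by
  split_ifs with h
  · obtain ⟨h0, hle⟩ := h
    symm
    refine Finset.card_bij (fun q _ => ⟨D + q.parts, fun {i} hi => ?_, ?_⟩) ?_ ?_ ?_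
    · rcases Multiset.mem_add.1 hi with hi | hi
      · exact Nat.pos_of_ne_zero fun h => h0 (h ▸ hi)
      · exact q.parts_pos hi
    · rw [Multiset.sum_add, q.parts_sum, Nat.add_sub_cancel' hle]
    · intro q hq
      simpa using hq
    · intro q _ q' _ h
      exact Nat.Partition.ext (add_left_cancel (congrArg Nat.Partition.parts h))
    · intro p hp
      obtain ⟨hD, hP⟩ := (Finset.mem_filter.1 hp).2
      have hadd : D + (p.parts - D) = p.parts := add_tsub_cancel_of_le hD
      refine ⟨⟨p.parts - D, fun {i} hi => p.parts_pos (Multiset.mem_of_le tsub_le_self hi), ?_⟩,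
        by simpa using hP, Nat.Partition.ext hadd⟩
      have := congrArg Multiset.sum hadd
      rw [Multiset.sum_add, p.parts_sum] at this
      omega
  · rw [Finset.card_eq_zero, Finset.filter_eq_empty_iff]
    rintro p - ⟨hD, -⟩
    refine h ⟨fun h0 => (p.parts_pos (Multiset.mem_of_le hD h0)).ne' rfl, ?_⟩
    have := congrArg Multiset.sum (add_tsub_cancel_of_le hD)
    rw [Multiset.sum_add, p.parts_sum] at this
    omega

namespace Multiset

/-- The elements of `s` divisible by `m`, each divided by `m`. -/
def divPart (m : ℕ) (s : Multiset ℕ) : Multiset ℕ :=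
  (s.filter (m ∣ ·)).map (· / m)

/-- The multiset whose multiplicities are those of `s` divided by `m`, rounded down. -/
noncomputable def countDiv (m : ℕ) (s : Multiset ℕ) : Multiset ℕ :=
  Finsupp.toMultiset ((Multiset.toFinsupp s).mapRange (· / m) (Nat.zero_div m))

theorem count_countDiv (m : ℕ) (s : Multiset ℕ) (k : ℕ) :
    (countDiv m s).count k = s.count k / m := by
  simp [countDiv]

theorem count_divPart {m : ℕ} (hm : 0 < m) (s : Multiset ℕ) (k : ℕ) :
    (divPart m s).count k = s.count (k * m) := by
  rw [divPart, count_map, filter_filter, count_eq_card_filter_eq]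
  congr 1
  refine filter_congr fun i _ => ⟨?_, ?_⟩
  · rintro ⟨rfl, h⟩
    exact Nat.div_mul_cancel h
  · rintro rfl
    exact ⟨(Nat.mul_div_cancel k hm).symm, dvd_mul_left m k⟩

theorem divPart_eq_iff {m : ℕ} (hm : 0 < m) (s t : Multiset ℕ) :
    t = divPart m s ↔ t.map (· * m) ≤ s ∧ ∀ i ∈ s - t.map (· * m), ¬ m ∣ i := by
  constructor
  · rintro rfl
    have h : (divPart m s).map (· * m) = s.filter (m ∣ ·) := by
      rw [divPart, map_map]
      conv_rhs => rw [← map_id (s.filter (m ∣ ·))]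
      refine map_congr rfl fun i hi => ?_
      exact Nat.div_mul_cancel (mem_filter.1 hi).2
    rw [h]
    refine ⟨filter_le _ _, ?_⟩
    rw [tsub_eq_of_eq_add_rev (filter_add_not (m ∣ ·) s).symm]
    exact fun i hi => (mem_filter.1 hi).2
  · rintro ⟨hle, hs⟩
    have hadd := add_tsub_cancel_of_le hle
    have h : s.filter (m ∣ ·) = t.map (· * m) := by
      conv_lhs => rw [← hadd]
      rw [filter_add, filter_eq_nil.2 hs, add_zero, filter_eq_self]
      intro i hi
      obtain ⟨k, -, rfl⟩ := mem_map.1 hi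
      exact dvd_mul_left m k
    rw [divPart, h, map_map]
    simp [Nat.mul_div_cancel _ hm]

theorem countDiv_eq_iff {m : ℕ} (hm : 0 < m) (s t : Multiset ℕ) :
    t = countDiv m s ↔ m • t ≤ s ∧ ∀ i ∈ s - m • t, (s - m • t).count i < m := by
  have hcount : (∀ i ∈ s - m • t, (s - m • t).count i < m) ↔
      ∀ i, s.count i - m * t.count i < m := by
    refine forall_congr' fun i => ?_
    rw [← count_pos, count_sub, count_nsmul]
    omega
  rw [hcount, Multiset.ext, le_iff_count, ← forall_and]
  refine forall_congr' fun i => ?_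
  rw [count_countDiv, count_nsmul, eq_comm, Nat.div_eq_iff hm, mul_comm m]
  omega

theorem card_eq_sum_count_Icc {s : Multiset ℕ} {n : ℕ} (h : ∀ i ∈ s, i ∈ Finset.Icc 1 n) :
    s.card = ∑ k ∈ Finset.Icc 1 n, s.count k :=
  (sum_count_eq_card h).symm

theorem sum_eq_sum_Icc_mul_count {s : Multiset ℕ} {n : ℕ} (h : ∀ i ∈ s, i ∈ Finset.Icc 1 n) :
    s.sum = ∑ k ∈ Finset.Icc 1 n, k * s.count k := by
  rw [Finset.sum_multiset_count_of_subset s (Finset.Icc 1 n) fun i hi => h i (mem_toFinset.1 hi)]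
  simp [mul_comm]

end Multiset

namespace Nat.Partition

/-- The statistics `divPart m` and `countDiv m` are equidistributed on the partitions of `n`. -/
theorem map_divPart_eq_map_countDiv {m : ℕ} (hm : 0 < m) (n : ℕ) :
    (Finset.univ : Finset n.Partition).val.map (fun p => p.parts.divPart m) =
      (Finset.univ : Finset n.Partition).val.map (fun p => p.parts.countDiv m) := by
  ext t
  rw [Multiset.count_map, Multiset.count_map]
  change (Finset.univ.filter fun p : n.Partition => t = p.parts.divPart m).card =
    (Finset.univ.filter fun p : n.Partition => t = p.parts.countDiv m).card
  simp_rw [Multiset.divPart_eq_iff hm, Multiset.countDiv_eq_iff hm]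
  rw [card_filter_le_and_sub n (t.map (· * m)) (fun s => ∀ i ∈ s, ¬ m ∣ i),
    card_filter_le_and_sub n (m • t) (fun s => ∀ i ∈ s, s.count i < m)]
  have hsum : (t.map (· * m)).sum = (m • t).sum := by
    rw [Multiset.sum_map_mul_right, Multiset.sum_nsmul, Multiset.map_id', smul_eq_mul, mul_comm]
  have hzero : 0 ∈ t.map (· * m) ↔ 0 ∈ m • t := by
    simp [Multiset.mem_nsmul, hm.ne']
  rw [hsum]
  simp only [hzero]
  refine if_congr Iff.rfl ?_ rfl
  exact card_restricted_eq_card_countRestricted _ hm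

end Nat.Partition

/-- For positive integers `m`, `n` and `ε ∈ {1, -1}`:
`Σ_{λ} ε^(t_m+t_{2m}+⋯) (t_m + 2t_{2m} + 3t_{3m} + ⋯)
  = Σ_{λ} ε^(⌊t_1/m⌋+⋯+⌊t_n/m⌋) (⌊t_1/m⌋ + 2⌊t_2/m⌋ + ⋯ + n⌊t_n/m⌋)`.
All terms with index `> n` vanish, so sums may be taken over `1 ≤ k ≤ n`. -/
theorem stmt_3 (m n : ℕ) (hm : 0 < m) (hn : 0 < n) (ε : ℤ)
    (hε : ε = 1 ∨ ε = -1) :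
    ∑ p : Nat.Partition n,
        ε ^ (∑ k ∈ Finset.Icc 1 n, p.parts.count (k * m)) *
          (∑ k ∈ Finset.Icc 1 n, (k : ℤ) * (p.parts.count (k * m) : ℤ))
      = ∑ p : Nat.Partition n,
        ε ^ (∑ k ∈ Finset.Icc 1 n, p.parts.count k / m) *
          (∑ k ∈ Finset.Icc 1 n, (k : ℤ) * ((p.parts.count k / m : ℕ) : ℤ)) := by
  have hdiv (p : n.Partition) : ∀ i ∈ p.parts.divPart m, i ∈ Finset.Icc 1 n := by
    intro i hi
    rw [← Multiset.count_pos, Multiset.count_divPart hm, Multiset.count_pos] at hi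
    rw [Finset.mem_Icc]
    exact ⟨Nat.pos_of_mul_pos_right (p.parts_pos hi),
      (Nat.le_mul_of_pos_right i hm).trans (p.le_of_mem_parts hi)⟩
  have hcount (p : n.Partition) : ∀ i ∈ p.parts.countDiv m, i ∈ Finset.Icc 1 n := by
    intro i hi
    rw [← Multiset.count_pos, Multiset.count_countDiv] at hi
    have hi' : i ∈ p.parts :=
      Multiset.count_pos.1 (hi.trans_le (Nat.div_le_self _ _))
    exact Finset.mem_Icc.2 ⟨p.parts_pos hi', p.le_of_mem_parts hi'⟩
  have key := congrArg
    (fun S : Multiset (Multiset ℕ) => (S.map fun s => ε ^ s.card * (s.sum : ℤ)).sum)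
    (Nat.Partition.map_divPart_eq_map_countDiv hm n)
  simp only [Multiset.map_map, Function.comp_def] at key
  convert key using 1
  · refine Finset.sum_congr rfl fun p _ => ?_
    rw [Multiset.card_eq_sum_count_Icc (hdiv p), Multiset.sum_eq_sum_Icc_mul_count (hdiv p)]
    simp [Multiset.count_divPart hm]
  · refine Finset.sum_congr rfl fun p _ => ?_
    rw [Multiset.card_eq_sum_count_Icc (hcount p), Multiset.sum_eq_sum_Icc_mul_count (hcount p)]
    simp [Multiset.count_countDiv]
end

section
/- Let n be a positive integer and let ε ∈ {1, -1}. Then Σ_{λ ∈ P(n)} ε^{t_2(λ)+t_4(λ)+t_6(λ)+⋯} (t_2(λ) + 2 t_4(λ) + 3 t_6(λ) + ⋯) = Σ_{λ ∈ P(n)} ε^{⌊t_1(λ)/2⌋+⌊t_2(λ)/2⌋+⋯+⌊t_n(λ)/2⌋} (⌊t_1(λ)/2⌋ + 2⌊t_2(λ)/2⌋ + ⋯ + n⌊t_n(λ)/2⌋), where both sums run over all partitions λ of n. -/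
/-- Removing a sub-multiset `D` from the parts is a bijection from the partitions of `k + D.sum`
containing `D` to the partitions of `k`. -/
theorem Nat.Partition.card_filter_le_parts (k : ℕ) (D : Multiset ℕ) (hD : ∀ i ∈ D, 0 < i)
    (P : Multiset ℕ → Prop) [DecidablePred P] :
    (Finset.univ.filter fun p : Nat.Partition (k + D.sum) ↦
        D ≤ p.parts ∧ P (p.parts - D)).card =
      (Finset.univ.filter fun q : Nat.Partition k ↦ P q.parts).card := by
  symm
  refine Finset.card_bij
    (fun q _ ↦ ⟨q.parts + D, fun {i} hi ↦ ?_, by rw [Multiset.sum_add, q.parts_sum]⟩) ?_ ?_ ?_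
  · rcases Multiset.mem_add.1 hi with h | h
    · exact q.parts_pos h
    · exact hD i h
  · intro q hq
    simpa using hq
  · intro q _ q' _ h
    exact Nat.Partition.ext (add_right_cancel (congrArg Nat.Partition.parts h))
  · intro p hp
    obtain ⟨hle, hP⟩ := (Finset.mem_filter.1 hp).2
    have hadd : p.parts - D + D = p.parts := Multiset.sub_add_cancel hle
    refine ⟨⟨p.parts - D, fun {i} hi ↦
      p.parts_pos (Multiset.mem_of_le (Multiset.sub_le_self _ _) hi),
      ?_⟩, by simpa using hP, Nat.Partition.ext hadd⟩
    have hs := congrArg Multiset.sum hadd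
    rw [Multiset.sum_add, p.parts_sum] at hs
    exact add_right_cancel hs

theorem Multiset.count_two_mul_eq_iff (s m : Multiset ℕ) :
    (∀ k, s.count (2 * k) = m.count k) ↔
      m.map (2 * ·) ≤ s ∧ ∀ i ∈ s - m.map (2 * ·), ¬ Even i := by
  have hinj : Function.Injective (2 * · : ℕ → ℕ) := fun a b h ↦ by simpa using h
  have hc (k : ℕ) : (m.map (2 * ·)).count (2 * k) = m.count k :=
    Multiset.count_map_eq_count' (2 * ·) m hinj k
  constructor
  · intro h
    refine ⟨Multiset.le_iff_count.2 fun i ↦ ?_, fun i hi hev ↦ ?_⟩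
    · rcases Nat.even_or_odd' i with ⟨k, rfl | rfl⟩
      · rw [hc, h]
      · rw [Multiset.count_eq_zero_of_notMem]
        · exact Nat.zero_le _
        · simp only [Multiset.mem_map, not_exists, not_and]
          omega
    · obtain ⟨k, rfl⟩ := hev.two_dvd
      have := Multiset.count_pos.2 hi
      rw [Multiset.count_sub, hc, h] at this
      omega
  · rintro ⟨hle, hodd⟩ k
    have h1 := Multiset.le_iff_count.1 hle (2 * k)
    have h2 : (s - m.map (2 * ·)).count (2 * k) = 0 :=
      Multiset.count_eq_zero.2 fun hk ↦ hodd _ hk (even_two_mul k)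
    rw [Multiset.count_sub] at h2
    rw [hc] at h1 h2
    omega

theorem Multiset.count_div_two_eq_iff {α : Type*} [DecidableEq α] (s m : Multiset α) :
    (∀ k, s.count k / 2 = m.count k) ↔ 2 • m ≤ s ∧ (s - 2 • m).Nodup := by
  simp only [Multiset.le_iff_count, Multiset.nodup_iff_count_le_one, Multiset.count_sub,
    Multiset.count_nsmul, ← forall_and]
  exact forall_congr' fun k ↦ by omega

namespace Nat.Partition

open Classical in
/-- The number of partitions of `n` with prescribed multiplicities of the even parts equals the
number of those in which the multiplicities have prescribed halves. -/
theorem card_filter_count_two_mul_eq (n : ℕ) (m : Multiset ℕ) (hm : 0 ∉ m) :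
    (Finset.univ.filter fun p : Nat.Partition n ↦
        ∀ k, p.parts.count (2 * k) = m.count k).card =
      (Finset.univ.filter fun p : Nat.Partition n ↦
        ∀ k, p.parts.count k / 2 = m.count k).card := by
  simp only [Multiset.count_two_mul_eq_iff, Multiset.count_div_two_eq_iff]
  have hpos {i : ℕ} (hi : i ∈ m) : 0 < i := Nat.pos_of_ne_zero fun h ↦ hm (h ▸ hi)
  have hsum : (m.map (2 * ·)).sum = (2 • m).sum := by
    rw [Multiset.sum_map_mul_left, Multiset.map_id', Multiset.sum_nsmul, smul_eq_mul]
  by_cases hn : (2 • m).sum ≤ n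
  · obtain ⟨k, rfl⟩ := Nat.exists_eq_add_of_le' hn
    rw [card_filter_le_parts k (2 • m) (fun i hi ↦ hpos (Multiset.mem_of_mem_nsmul hi))
      Multiset.Nodup, ← hsum, card_filter_le_parts k (m.map (2 * ·)) (fun i hi ↦ ?_)
      (fun s ↦ ∀ i ∈ s, ¬ Even i)]
    · exact card_odds_eq_card_distincts k
    · obtain ⟨j, hj, rfl⟩ := Multiset.mem_map.1 hi
      exact Nat.mul_pos two_pos (hpos hj)
  · have hle {D : Multiset ℕ} (p : Nat.Partition n) (h : D ≤ p.parts) : D.sum ≤ n := by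
      rw [← p.parts_sum, ← Multiset.sub_add_cancel h, Multiset.sum_add]
      exact Nat.le_add_left _ _
    rw [Finset.filter_false_of_mem fun p _ h ↦ hn (hsum ▸ hle p h.1),
      Finset.filter_false_of_mem fun p _ h ↦ hn (hle p h.1)]

theorem finite_support_count {n : ℕ} (p : Nat.Partition n) :
    (Function.support fun k ↦ p.parts.count k).Finite :=
  p.parts.toFinset.finite_toSet.subset fun k hk ↦ by
    simpa [Multiset.count_eq_zero] using hk

open Classical in
/-- The multiplicities of the even parts and the halved multiplicities of all parts are
equidistributed over the partitions of `n`. -/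
theorem card_fiber_count_two_mul_eq (n : ℕ) (c : ℕ → ℕ) :
    Fintype.card {p : Nat.Partition n // (fun k ↦ p.parts.count (2 * k)) = c} =
      Fintype.card {p : Nat.Partition n // (fun k ↦ p.parts.count k / 2) = c} := by
  have hzero {p : Nat.Partition n} : p.parts.count 0 = 0 :=
    Multiset.count_eq_zero.2 fun h ↦ (p.parts_pos h).false
  by_cases hc : c.support.Finite ∧ c 0 = 0
  · obtain ⟨hfin, h0⟩ := hc
    have hm (k : ℕ) : (Finsupp.toMultiset (Finsupp.ofSupportFinite c hfin)).count k = c k := by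
      rw [Finsupp.count_toMultiset, Finsupp.ofSupportFinite_coe]
    have := card_filter_count_two_mul_eq n _
      (Multiset.count_eq_zero.1 ((hm 0).trans h0))
    simp only [hm] at this
    simpa only [Fintype.card_subtype, funext_iff] using this
  · have h1 : IsEmpty {p : Nat.Partition n // (fun k ↦ p.parts.count (2 * k)) = c} := by
      refine ⟨fun ⟨p, hp⟩ ↦ hc ?_⟩
      subst hp
      exact ⟨p.finite_support_count.preimage
        (f := (2 * · : ℕ → ℕ)) (fun a _ b _ h ↦ by simpa using h), hzero⟩
    have h2 : IsEmpty {p : Nat.Partition n // (fun k ↦ p.parts.count k / 2) = c} := by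
      refine ⟨fun ⟨p, hp⟩ ↦ hc ?_⟩
      subst hp
      refine ⟨p.finite_support_count.subset fun k hk h ↦ hk ?_, ?_⟩
      · simp_all
      · simp [hzero]
    rw [Fintype.card_eq_zero, Fintype.card_eq_zero]

theorem sum_count_two_mul_eq {M : Type*} [AddCommMonoid M] (n : ℕ) (F : (ℕ → ℕ) → M) :
    ∑ p : Nat.Partition n, F (fun k ↦ p.parts.count (2 * k)) =
      ∑ p : Nat.Partition n, F (fun k ↦ p.parts.count k / 2) := by
  classical
  let e := fun c : ℕ → ℕ ↦ Fintype.equivOfCardEq (card_fiber_count_two_mul_eq n c)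
  exact Fintype.sum_equiv (Equiv.ofFiberEquiv e) _ _ fun p ↦
    congrArg F (Equiv.ofFiberEquiv_map e p).symm

end Nat.Partition

/-- For a positive integer `n` and `ε ∈ {1, -1}`:
`Σ_{λ} ε^(t_2+t_4+t_6+⋯) (t_2 + 2t_4 + 3t_6 + ⋯)
  = Σ_{λ} ε^(⌊t_1/2⌋+⋯+⌊t_n/2⌋) (⌊t_1/2⌋ + 2⌊t_2/2⌋ + ⋯ + n⌊t_n/2⌋)`.
All terms with index `> n` vanish, so sums may be taken over `1 ≤ k ≤ n`. -/
theorem stmt_5 (n : ℕ) (hn : 0 < n) (ε : ℤ) (hε : ε = 1 ∨ ε = -1) :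
    ∑ p : Nat.Partition n,
        ε ^ (∑ k ∈ Finset.Icc 1 n, p.parts.count (2 * k)) *
          (∑ k ∈ Finset.Icc 1 n, (k : ℤ) * (p.parts.count (2 * k) : ℤ))
      = ∑ p : Nat.Partition n,
        ε ^ (∑ k ∈ Finset.Icc 1 n, p.parts.count k / 2) *
          (∑ k ∈ Finset.Icc 1 n, (k : ℤ) * ((p.parts.count k / 2 : ℕ) : ℤ)) := by
  exact Nat.Partition.sum_count_two_mul_eq n fun c ↦
    ε ^ (∑ k ∈ Finset.Icc 1 n, c k) * ∑ k ∈ Finset.Icc 1 n, (k : ℤ) * (c k : ℤ)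
end

section
/- Let n be a positive integer and let ε ∈ {1, -1}. Then Σ_{λ ∈ P(n)} ε^{t_2(λ)+t_4(λ)+t_6(λ)+⋯} (t_1(λ) + 3 t_3(λ) + 5 t_5(λ) + ⋯) = Σ_{λ ∈ P(n)} ε^{⌊t_1(λ)/2⌋+⌊t_2(λ)/2⌋+⋯+⌊t_n(λ)/2⌋} (⟨t_1(λ)⟩_2 + 2⟨t_2(λ)⟩_2 + ⋯ + n⟨t_n(λ)⟩_2), where both sums run over all partitions λ of n. -/
/-- If every multiset of positive integers is uniquely `μ + g ν` with `μ` satisfying `A`, where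
`g` doubles sums, then a sum over partitions of `n` of a weight `ε ^ card ν * μ.sum` is
determined by the numbers of partitions satisfying `A`. -/
theorem sum_partition_eq_of_decomposition (n : ℕ) (ε : ℤ) (A : Multiset ℕ → Prop)
    [DecidablePred A] (g : Multiset ℕ → Multiset ℕ)
    (g_sum : ∀ ν, (g ν).sum = 2 * ν.sum)
    (g_pos : ∀ ν, (∀ x ∈ ν, 0 < x) → ∀ x ∈ g ν, 0 < x)
    (g_inj : ∀ μ μ' ν ν', A μ → A μ' → μ + g ν = μ' + g ν' → μ = μ' ∧ ν = ν')
    (g_surj : ∀ l : Multiset ℕ, (∀ x ∈ l, 0 < x) →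
      ∃ μ ν, A μ ∧ (∀ x ∈ ν, 0 < x) ∧ μ + g ν = l)
    (F : Multiset ℕ → ℤ)
    (hF : ∀ μ ν, A μ → (∀ x ∈ μ, x ∈ Finset.Icc 1 n) → (∀ x ∈ ν, x ∈ Finset.Icc 1 n) →
      F (μ + g ν) = ε ^ ν.card * (μ.sum : ℤ)) :
    ∑ p : Nat.Partition n, F p.parts =
      ∑ k ∈ Finset.range (n / 2 + 1),
        ((Finset.univ.filter fun μ : Nat.Partition (n - 2 * k) => A μ.parts).card : ℤ) *
          ∑ ν : Nat.Partition k, ε ^ ν.parts.card * ((n - 2 * k : ℕ) : ℤ) := by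
  have expand : ∀ k ∈ Finset.range (n / 2 + 1),
      ((Finset.univ.filter fun μ : Nat.Partition (n - 2 * k) => A μ.parts).card : ℤ) *
          ∑ ν : Nat.Partition k, ε ^ ν.parts.card * ((n - 2 * k : ℕ) : ℤ) =
      ∑ x ∈ (Finset.univ.filter fun μ : Nat.Partition (n - 2 * k) => A μ.parts) ×ˢ
          (Finset.univ : Finset (Nat.Partition k)),
        ε ^ x.2.parts.card * ((n - 2 * k : ℕ) : ℤ) := by
    intro k _
    rw [Finset.sum_product]
    dsimp only
    rw [Finset.sum_const, nsmul_eq_mul]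
  rw [Finset.sum_congr rfl expand, Finset.sum_sigma']
  symm
  have sum_le : ∀ k ∈ Finset.range (n / 2 + 1), n - 2 * k + 2 * k = n := by
    intro k hk
    have := Finset.mem_range.mp hk
    omega
  refine Finset.sum_bij (fun x hx => (⟨x.2.1.parts + g x.2.2.parts, ?_, ?_⟩ : Nat.Partition n))
    ?_ ?_ ?_ ?_
  · intro i hi
    rcases Multiset.mem_add.mp hi with h | h
    · exact x.2.1.parts_pos h
    · exact g_pos _ (fun y hy => x.2.2.parts_pos hy) i h
  · rw [Multiset.sum_add, g_sum, x.2.1.parts_sum, x.2.2.parts_sum]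
    exact sum_le _ (Finset.mem_sigma.mp hx).1
  · intro x _
    exact Finset.mem_univ _
  · rintro ⟨k, μ, ν⟩ hx ⟨k', μ', ν'⟩ hx' h
    simp only [Finset.mem_sigma, Finset.mem_product, Finset.mem_filter, Finset.mem_univ,
      true_and, and_true] at hx hx'
    obtain ⟨hμ, hν⟩ := g_inj _ _ _ _ hx.2 hx'.2 (congrArg Nat.Partition.parts h)
    have hk : k = k' := by rw [← ν.parts_sum, ← ν'.parts_sum, hν]
    subst hk
    obtain rfl : μ = μ' := Nat.Partition.ext hμ
    obtain rfl : ν = ν' := Nat.Partition.ext hν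
    rfl
  · intro p _
    obtain ⟨μ, ν, hA, hν, h⟩ := g_surj p.parts (fun x hx => p.parts_pos hx)
    have hs : μ.sum + 2 * ν.sum = n := by
      rw [← g_sum, ← Multiset.sum_add, h, p.parts_sum]
    refine ⟨⟨ν.sum, ⟨μ, ?_, ?_⟩, ⟨ν, fun {i} hi => hν i hi, rfl⟩⟩, ?_, ?_⟩
    · intro i hi
      exact p.parts_pos (h ▸ Multiset.mem_add.mpr (Or.inl hi))
    · omega
    · simp only [Finset.mem_sigma, Finset.mem_product, Finset.mem_filter, Finset.mem_univ,
        true_and, and_true, Finset.mem_range]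
      exact ⟨by omega, hA⟩
    · exact Nat.Partition.ext h
  · rintro ⟨k, μ, ν⟩ hx
    simp only [Finset.mem_sigma, Finset.mem_product, Finset.mem_filter, Finset.mem_univ,
      true_and, and_true] at hx
    have hk := sum_le k hx.1
    rw [hF _ _ hx.2, μ.parts_sum]
    · intro i hi
      have := μ.le_of_mem_parts hi
      exact Finset.mem_Icc.mpr ⟨μ.parts_pos hi, by omega⟩
    · intro i hi
      have := ν.le_of_mem_parts hi
      exact Finset.mem_Icc.mpr ⟨ν.parts_pos hi, by omega⟩

theorem exists_odd_add_map_two_mul (l : Multiset ℕ) (hl : ∀ x ∈ l, 0 < x) :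
    ∃ μ ν : Multiset ℕ, (∀ x ∈ μ, ¬ Even x) ∧ (∀ x ∈ ν, 0 < x) ∧ μ + ν.map (2 * ·) = l := by
  induction l using Multiset.induction with
  | empty => exact ⟨0, 0, by simp⟩
  | cons a l ih =>
    rw [Multiset.forall_mem_cons] at hl
    obtain ⟨μ, ν, hμ, hν, h⟩ := ih hl.2
    rcases Nat.even_or_odd' a with ⟨b, rfl | rfl⟩
    · refine ⟨μ, b ::ₘ ν, hμ, Multiset.forall_mem_cons.mpr ⟨by omega, hν⟩, ?_⟩
      rw [Multiset.map_cons, Multiset.add_cons, h]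
    · refine ⟨(2 * b + 1) ::ₘ μ, ν, Multiset.forall_mem_cons.mpr ⟨by simp, hμ⟩, hν, ?_⟩
      rw [Multiset.cons_add, h]

theorem exists_nodup_add_two_nsmul (l : Multiset ℕ) (hl : ∀ x ∈ l, 0 < x) :
    ∃ μ ν : Multiset ℕ, μ.Nodup ∧ (∀ x ∈ ν, 0 < x) ∧ μ + 2 • ν = l := by
  induction l using Multiset.induction with
  | empty => exact ⟨0, 0, by simp⟩
  | cons a l ih =>
    rw [Multiset.forall_mem_cons] at hl
    obtain ⟨μ, ν, hμ, hν, h⟩ := ih hl.2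
    by_cases ha : a ∈ μ
    · refine ⟨μ.erase a, a ::ₘ ν, hμ.erase a, Multiset.forall_mem_cons.mpr ⟨hl.1, hν⟩, ?_⟩
      rw [← h, two_nsmul, two_nsmul]
      nth_rw 2 [← Multiset.cons_erase ha]
      simp only [Multiset.cons_add, Multiset.add_cons]
    · refine ⟨a ::ₘ μ, ν, Multiset.nodup_cons.mpr ⟨ha, hμ⟩, hν, ?_⟩
      rw [Multiset.cons_add, h]

theorem count_two_mul_add_map {μ : Multiset ℕ} (hμ : ∀ x ∈ μ, ¬ Even x) (ν : Multiset ℕ)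
    (k : ℕ) : (μ + ν.map (2 * ·)).count (2 * k) = ν.count k := by
  rw [Multiset.count_add, Multiset.count_eq_zero_of_notMem fun h => hμ _ h (by simp), zero_add,
    Multiset.count_map_eq_count' (2 * ·) _ (mul_right_injective₀ two_ne_zero)]

theorem count_add_map_of_not_even (μ ν : Multiset ℕ) {i : ℕ} (hi : ¬ Even i) :
    (μ + ν.map (2 * ·)).count i = μ.count i := by
  rw [Multiset.count_add, Multiset.count_eq_zero_of_notMem (s := ν.map (2 * ·)), add_zero]
  intro h
  obtain ⟨b, _, rfl⟩ := Multiset.mem_map.mp h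
  exact hi (by simp)

theorem count_add_two_nsmul {μ : Multiset ℕ} (hμ : μ.Nodup) (ν : Multiset ℕ) (k : ℕ) :
    (μ + 2 • ν).count k / 2 = ν.count k ∧ (μ + 2 • ν).count k % 2 = μ.count k := by
  have := Multiset.nodup_iff_count_le_one.mp hμ k
  rw [Multiset.count_add, Multiset.count_nsmul]
  omega

theorem sum_mul_count_eq_sum {μ : Multiset ℕ} {s : Finset ℕ} (h : ∀ x ∈ μ, x ∈ s) :
    ∑ i ∈ s, (i : ℤ) * (μ.count i : ℤ) = (μ.sum : ℤ) := by
  rw [Finset.sum_multiset_count_of_subset μ s fun x hx => h x (Multiset.mem_toFinset.mp hx)]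
  push_cast
  exact Finset.sum_congr rfl fun i _ => by rw [nsmul_eq_mul, mul_comm]; rfl


/-- For a positive integer `n` and `ε ∈ {1, -1}`:
`Σ_{λ} ε^(t_2+t_4+⋯) (t_1 + 3t_3 + 5t_5 + ⋯)
  = Σ_{λ} ε^(⌊t_1/2⌋+⋯+⌊t_n/2⌋) (⟨t_1⟩_2 + 2⟨t_2⟩_2 + ⋯ + n⟨t_n⟩_2)`,
where `⟨x⟩_2 = x % 2`. All terms with index `> n` vanish, so sums may be taken over
indices at most `n`. -/
theorem stmt_6 (n : ℕ) (hn : 0 < n) (ε : ℤ) (hε : ε = 1 ∨ ε = -1) :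
    ∑ p : Nat.Partition n,
        ε ^ (∑ k ∈ Finset.Icc 1 n, p.parts.count (2 * k)) *
          (∑ i ∈ (Finset.Icc 1 n).filter (fun i => ¬ 2 ∣ i),
            (i : ℤ) * (p.parts.count i : ℤ))
      = ∑ p : Nat.Partition n,
        ε ^ (∑ k ∈ Finset.Icc 1 n, p.parts.count k / 2) *
          (∑ i ∈ Finset.Icc 1 n, (i : ℤ) * ((p.parts.count i % 2 : ℕ) : ℤ)) := by
  rw [sum_partition_eq_of_decomposition n ε (fun μ => ∀ x ∈ μ, ¬ Even x)
      (fun ν => ν.map (2 * ·)) ?_ ?_ ?_ exists_odd_add_map_two_mul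
      (fun l => ε ^ (∑ k ∈ Finset.Icc 1 n, l.count (2 * k)) *
        ∑ i ∈ (Finset.Icc 1 n).filter (fun i => ¬ 2 ∣ i), (i : ℤ) * (l.count i : ℤ)) ?_,
    sum_partition_eq_of_decomposition n ε Multiset.Nodup (fun ν => 2 • ν) ?_ ?_ ?_
      exists_nodup_add_two_nsmul
      (fun l => ε ^ (∑ k ∈ Finset.Icc 1 n, l.count k / 2) *
        ∑ i ∈ Finset.Icc 1 n, (i : ℤ) * ((l.count i % 2 : ℕ) : ℤ)) ?_]
  · refine Finset.sum_congr rfl fun k _ => ?_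
    congr 2
    exact Nat.Partition.card_odds_eq_card_distincts (n - 2 * k)
  · intro ν
    rw [Multiset.sum_nsmul, smul_eq_mul]
  · intro ν hν x hx
    exact hν x (Multiset.mem_of_mem_nsmul hx)
  · intro μ μ' ν ν' hμ hμ' h
    constructor <;> ext k
    · rw [← (count_add_two_nsmul hμ ν k).2, ← (count_add_two_nsmul hμ' ν' k).2, h]
    · rw [← (count_add_two_nsmul hμ ν k).1, ← (count_add_two_nsmul hμ' ν' k).1, h]
  · intro μ ν hA hμ hν
    simp only [count_add_two_nsmul hA, sum_mul_count_eq_sum hμ, Multiset.sum_count_eq_card hν]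
  · intro ν
    rw [Multiset.sum_map_mul_left, Multiset.map_id']
  · intro ν hν x hx
    obtain ⟨b, hb, rfl⟩ := Multiset.mem_map.mp hx
    have := hν b hb
    omega
  · intro μ μ' ν ν' hμ hμ' h
    constructor <;> ext k
    · by_cases hk : Even k
      · rw [Multiset.count_eq_zero_of_notMem fun h => hμ _ h hk,
          Multiset.count_eq_zero_of_notMem fun h => hμ' _ h hk]
      · rw [← count_add_map_of_not_even μ ν hk, ← count_add_map_of_not_even μ' ν' hk, h]
    · rw [← count_two_mul_add_map hμ ν k, ← count_two_mul_add_map hμ' ν' k, h]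
  · intro μ ν hA hμ hν
    have odd_count : ∀ i ∈ (Finset.Icc 1 n).filter (fun i => ¬ 2 ∣ i),
        (i : ℤ) * ((μ + ν.map (2 * ·)).count i : ℤ) = (i : ℤ) * (μ.count i : ℤ) := by
      intro i hi
      rw [count_add_map_of_not_even μ ν (even_iff_two_dvd.not.mpr (Finset.mem_filter.mp hi).2)]
    simp only [count_two_mul_add_map hA, Multiset.sum_count_eq_card hν]
    rw [Finset.sum_congr rfl odd_count, sum_mul_count_eq_sum]
    intro x hx
    exact Finset.mem_filter.mpr ⟨hμ x hx, even_iff_two_dvd.not.mp (hA x hx)⟩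
end

section
/- Let m and n be positive integers and let x_1, x_2, …, x_n and z be real numbers. Then Σ_{λ ∈ P(n)} (Π_{k=1}^{n} x_k^{t_{km}(λ)}) · z^{γ_m(λ)} = Σ_{λ ∈ P(n)} (Π_{k=1}^{n} x_k^{⌊t_k(λ)/m⌋}) · z^{γ'_m(λ)}, where both sums run over all partitions λ of n, γ_m(λ) = Σ_{i : m ∤ i} i·t_i(λ) is the sum of the parts of λ not divisible by m, and γ'_m(λ) = Σ_{i=1}^{n} i·⟨t_i(λ)⟩_m. -/
namespace Multiset

/-- The multiset of quotients by `m` of those elements of `s` that are multiples of `m`. -/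
def quotients (m : ℕ) (s : Multiset ℕ) : Multiset ℕ :=
  (s.filter (m ∣ ·)).map (· / m)

/-- The multiset in which `a` occurs `⌊s.count a / m⌋` times. -/
def divCount {α : Type*} [DecidableEq α] (m : ℕ) (s : Multiset α) : Multiset α :=
  ∑ a ∈ s.toFinset, replicate (s.count a / m) a

/-- The multiset in which `a` occurs `s.count a % m` times. -/
def modCount {α : Type*} [DecidableEq α] (m : ℕ) (s : Multiset α) : Multiset α :=
  s - m • s.divCount m

theorem map_mul_quotients (m : ℕ) (s : Multiset ℕ) :
    (s.quotients m).map (· * m) = s.filter (m ∣ ·) := by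
  rw [quotients, map_map]
  conv_rhs => rw [← map_id (s.filter (m ∣ ·))]
  refine map_congr rfl fun a ha => ?_
  exact Nat.div_mul_cancel (mem_filter.1 ha).2

theorem filter_not_dvd_add_map_mul_quotients (m : ℕ) (s : Multiset ℕ) :
    s.filter (¬ m ∣ ·) + (s.quotients m).map (· * m) = s := by
  rw [map_mul_quotients, add_comm, filter_add_not]

theorem count_quotients {m : ℕ} (hm : 0 < m) (s : Multiset ℕ) (k : ℕ) :
    (s.quotients m).count k = s.count (k * m) := by
  rw [← count_map_eq_count' (· * m) _ (mul_left_injective₀ hm.ne'), map_mul_quotients,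
    count_filter_of_pos (Nat.dvd_mul_left m k)]

theorem quotients_add_map_mul {m : ℕ} (hm : 0 < m) {s : Multiset ℕ} (hs : ∀ i ∈ s, ¬ m ∣ i)
    (t : Multiset ℕ) : (s + t.map (· * m)).quotients m = t := by
  ext k
  rw [count_quotients hm, count_add, count_map_eq_count' (· * m) _ (mul_left_injective₀ hm.ne'),
    count_eq_zero_of_notMem fun h => hs _ h (Nat.dvd_mul_left m k), zero_add]

theorem filter_not_dvd_add_map_mul {m : ℕ} {s : Multiset ℕ} (hs : ∀ i ∈ s, ¬ m ∣ i)
    (t : Multiset ℕ) : (s + t.map (· * m)).filter (¬ m ∣ ·) = s := by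
  rw [filter_add, filter_eq_self.2 hs, filter_eq_nil.2, add_zero]
  simp

section Count

variable {α : Type*} [DecidableEq α]

theorem count_divCount (m : ℕ) (s : Multiset α) (a : α) :
    (s.divCount m).count a = s.count a / m := by
  simp +contextual [divCount, count_sum', count_replicate, count_eq_zero_of_notMem]

theorem count_modCount (m : ℕ) (s : Multiset α) (a : α) :
    (s.modCount m).count a = s.count a % m := by
  rw [modCount, count_sub, count_nsmul, count_divCount, Nat.mod_eq_sub]

theorem modCount_add_nsmul_divCount (m : ℕ) (s : Multiset α) :
    s.modCount m + m • s.divCount m = s := by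
  ext a
  rw [count_add, count_nsmul, count_modCount, count_divCount, Nat.mod_add_div]

theorem divCount_add_nsmul {m : ℕ} (hm : 0 < m) {s : Multiset α} (hs : ∀ i ∈ s, s.count i < m)
    (t : Multiset α) : (s + m • t).divCount m = t := by
  ext a
  have h : s.count a < m := by
    by_cases ha : a ∈ s
    · exact hs a ha
    · rwa [count_eq_zero_of_notMem ha]
  rw [count_divCount, count_add, count_nsmul, Nat.add_mul_div_left _ _ hm, Nat.div_eq_of_lt h,
    zero_add]

theorem modCount_add_nsmul {m : ℕ} (hm : 0 < m) {s : Multiset α} (hs : ∀ i ∈ s, s.count i < m)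
    (t : Multiset α) : (s + m • t).modCount m = s := by
  rw [modCount, divCount_add_nsmul hm hs, Multiset.add_sub_cancel_right]

end Count

end Multiset

namespace Nat.Partition

theorem sum_filter_not_dvd_parts {n : ℕ} (m : ℕ) (p : n.Partition) :
    (p.parts.filter (¬ m ∣ ·)).sum = n - m * (p.parts.quotients m).sum ∧
      m * (p.parts.quotients m).sum ≤ n := by
  have h := congrArg Multiset.sum (p.parts.filter_not_dvd_add_map_mul_quotients m)
  rw [Multiset.sum_add, Multiset.sum_map_mul_right, Multiset.map_id', p.parts_sum, mul_comm] at h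
  omega

theorem sum_modCount_parts {n : ℕ} (m : ℕ) (p : n.Partition) :
    (p.parts.modCount m).sum = n - m * (p.parts.divCount m).sum ∧
      m * (p.parts.divCount m).sum ≤ n := by
  have h := congrArg Multiset.sum (p.parts.modCount_add_nsmul_divCount m)
  rw [Multiset.sum_add, Multiset.sum_nsmul, p.parts_sum, smul_eq_mul] at h
  omega

theorem sum_eq_sum_Icc_mul_count {n : ℕ} {p : n.Partition} {s : Multiset ℕ} (hs : s ≤ p.parts) :
    s.sum = ∑ i ∈ Finset.Icc 1 n, i * s.count i := by
  rw [Finset.sum_multiset_count_of_subset s (Finset.Icc 1 n)]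
  · simp [mul_comm]
  · intro i hi
    have hi' := Multiset.mem_of_le hs (Multiset.mem_toFinset.1 hi)
    exact Finset.mem_Icc.2 ⟨p.parts_pos hi', le_of_mem_parts hi'⟩

theorem card_filter_quotients_eq {m n : ℕ} (hm : 0 < m) {μ : Multiset ℕ} (hμ : 0 ∉ μ)
    (hn : m * μ.sum ≤ n) :
    (Finset.univ.filter fun p : n.Partition => p.parts.quotients m = μ).card =
      (restricted (n - m * μ.sum) (¬ m ∣ ·)).card := by
  refine Finset.card_bij'
    (fun p hp => ⟨p.parts.filter (¬ m ∣ ·),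
      fun h => p.parts_pos (Multiset.mem_of_mem_filter h), by
        rw [(p.sum_filter_not_dvd_parts m).1, (Finset.mem_filter.1 hp).2]⟩)
    (fun q _ => ⟨q.parts + μ.map (· * m), ?_, ?_⟩) ?_ ?_ ?_ ?_
  · intro i hi
    rcases Multiset.mem_add.1 hi with hi | hi
    · exact q.parts_pos hi
    · obtain ⟨k, hk, rfl⟩ := Multiset.mem_map.1 hi
      exact Nat.mul_pos (Nat.pos_of_ne_zero fun h => hμ (h ▸ hk)) hm
  · rw [Multiset.sum_add, Multiset.sum_map_mul_right, Multiset.map_id', q.parts_sum, mul_comm μ.sum,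
      Nat.sub_add_cancel hn]
  · intro p _
    simp [restricted]
  · intro q hq
    exact Finset.mem_filter.2 ⟨Finset.mem_univ _,
      Multiset.quotients_add_map_mul hm (Finset.mem_filter.1 hq).2 μ⟩
  · intro p hp
    ext1
    simp only [← (Finset.mem_filter.1 hp).2, Multiset.filter_not_dvd_add_map_mul_quotients]
  · intro q hq
    ext1
    exact Multiset.filter_not_dvd_add_map_mul (Finset.mem_filter.1 hq).2 μ

theorem card_filter_divCount_eq {m n : ℕ} (hm : 0 < m) {μ : Multiset ℕ} (hμ : 0 ∉ μ)
    (hn : m * μ.sum ≤ n) :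
    (Finset.univ.filter fun p : n.Partition => p.parts.divCount m = μ).card =
      (countRestricted (n - m * μ.sum) m).card := by
  refine Finset.card_bij'
    (fun p hp => ⟨p.parts.modCount m,
      fun h => p.parts_pos (Multiset.mem_of_le (Multiset.sub_le_self _ _) h), by
        rw [(p.sum_modCount_parts m).1, (Finset.mem_filter.1 hp).2]⟩)
    (fun q _ => ⟨q.parts + m • μ, ?_, ?_⟩) ?_ ?_ ?_ ?_
  · intro i hi
    rcases Multiset.mem_add.1 hi with hi | hi
    · exact q.parts_pos hi
    · exact Nat.pos_of_ne_zero fun h => hμ (h ▸ Multiset.mem_of_mem_nsmul hi)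
  · rw [Multiset.sum_add, Multiset.sum_nsmul, q.parts_sum, smul_eq_mul, Nat.sub_add_cancel hn]
  · intro p _
    simp [countRestricted, Multiset.count_modCount, Nat.mod_lt _ hm]
  · intro q hq
    exact Finset.mem_filter.2 ⟨Finset.mem_univ _,
      Multiset.divCount_add_nsmul hm (Finset.mem_filter.1 hq).2 μ⟩
  · intro p hp
    ext1
    simp only [← (Finset.mem_filter.1 hp).2, Multiset.modCount_add_nsmul_divCount]
  · intro q hq
    ext1
    exact Multiset.modCount_add_nsmul hm (Finset.mem_filter.1 hq).2 μ

theorem zero_notMem_quotients_parts {m n : ℕ} (hm : 0 < m) (p : n.Partition) :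
    0 ∉ p.parts.quotients m := by
  rw [← Multiset.count_eq_zero, Multiset.count_quotients hm, zero_mul, Multiset.count_eq_zero]
  exact fun h => (p.parts_pos h).ne rfl

theorem zero_notMem_divCount_parts {n : ℕ} (m : ℕ) (p : n.Partition) :
    0 ∉ p.parts.divCount m := by
  rw [← Multiset.count_eq_zero, Multiset.count_divCount, Multiset.count_eq_zero.2, Nat.zero_div]
  exact fun h => (p.parts_pos h).ne rfl

/-- A weighted refinement of Glaisher's theorem: the multisets `quotients m` and `divCount m` are
equidistributed over the partitions of `n`. -/
theorem sum_quotients_eq_sum_divCount {M : Type*} [AddCommMonoid M] {m : ℕ} (hm : 0 < m) (n : ℕ)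
    (f : Multiset ℕ → M) :
    ∑ p : n.Partition, f (p.parts.quotients m) = ∑ p : n.Partition, f (p.parts.divCount m) := by
  classical
  let T : Finset (Multiset ℕ) := Finset.univ.image (fun p : n.Partition => p.parts.quotients m) ∪
    Finset.univ.image (fun p : n.Partition => p.parts.divCount m)
  have hT : ∀ μ ∈ T, 0 ∉ μ ∧ m * μ.sum ≤ n := by
    intro μ hμ
    simp only [T, Finset.mem_union, Finset.mem_image, Finset.mem_univ, true_and] at hμ
    rcases hμ with ⟨p, rfl⟩ | ⟨p, rfl⟩
    · exact ⟨p.zero_notMem_quotients_parts hm, (p.sum_filter_not_dvd_parts m).2⟩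
    · exact ⟨p.zero_notMem_divCount_parts m, (p.sum_modCount_parts m).2⟩
  rw [← Finset.sum_fiberwise_of_maps_to' (t := T) (g := fun p : n.Partition => p.parts.quotients m)
      (f := f) (by simp +contextual [T]),
    ← Finset.sum_fiberwise_of_maps_to' (t := T) (g := fun p : n.Partition => p.parts.divCount m)
      (f := f) (by simp +contextual [T])]
  refine Finset.sum_congr rfl fun μ hμ => ?_
  rw [Finset.sum_const, Finset.sum_const, card_filter_quotients_eq hm (hT μ hμ).1 (hT μ hμ).2,
    card_filter_divCount_eq hm (hT μ hμ).1 (hT μ hμ).2,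
    card_restricted_eq_card_countRestricted _ hm]

end Nat.Partition


/-- For positive integers `m`, `n` and real numbers `x_1, …, x_n`, `z`:
`Σ_{λ} (Π_{k=1}^n x_k^(t_{km}(λ))) z^(γ_m(λ)) = Σ_{λ} (Π_{k=1}^n x_k^(⌊t_k(λ)/m⌋)) z^(γ'_m(λ))`,
where `γ_m(λ) = Σ_{m ∤ i} i·t_i(λ)` and `γ'_m(λ) = Σ_i i·(t_i(λ) % m)`.
All terms with index `> n` vanish, so sums may be taken over `1 ≤ i ≤ n`. -/
theorem stmt_7 (m n : ℕ) (hm : 0 < m) (hn : 0 < n) (x : ℕ → ℝ) (z : ℝ) :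
    ∑ p : Nat.Partition n,
        (∏ k ∈ Finset.Icc 1 n, x k ^ p.parts.count (k * m)) *
          z ^ (∑ i ∈ (Finset.Icc 1 n).filter (fun i => ¬ m ∣ i), i * p.parts.count i)
      = ∑ p : Nat.Partition n,
        (∏ k ∈ Finset.Icc 1 n, x k ^ (p.parts.count k / m)) *
          z ^ (∑ i ∈ Finset.Icc 1 n, i * (p.parts.count i % m)) := by
  convert Nat.Partition.sum_quotients_eq_sum_divCount hm n fun μ =>
    (∏ k ∈ Finset.Icc 1 n, x k ^ μ.count k) * z ^ (n - m * μ.sum) using 3 with p _ p _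
  · simp only [Multiset.count_quotients hm]
  · rw [← (p.sum_filter_not_dvd_parts m).1,
      Nat.Partition.sum_eq_sum_Icc_mul_count (Multiset.filter_le _ _), Finset.sum_filter]
    simp only [Multiset.count_filter, mul_ite, mul_zero]
  · simp only [Multiset.count_divCount]
  · rw [← (p.sum_modCount_parts m).1,
      Nat.Partition.sum_eq_sum_Icc_mul_count (s := p.parts.modCount m)
        (Multiset.sub_le_self _ _)]
    simp only [Multiset.count_modCount]
end

section
/- Let n be a positive integer and let m ≥ 2 be an integer. There exists a bijection σ from the set of partitions of n to itself such that for every partition λ of n and every positive integer k, t_{km}(λ) = ⌊t_k(σ(λ))/m⌋, and moreover γ_m(λ) = γ'_m(σ(λ)), where γ_m(λ) = Σ_{i : m ∤ i} i·t_i(λ) is the sum of the parts of λ not divisible by m and γ'_m(μ) = Σ_{i≥1} i·⟨t_i(μ)⟩_m. -/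
namespace Nat.Partition

/-- Partitions containing a fixed multiset of parts correspond to partitions of the remainder. -/
theorem card_eq_card_of_parts_eq_add {n l : ℕ} {A : Multiset ℕ} (hA : 0 ∉ A)
    (hl : A.sum + l = n) (F : Finset n.Partition) (G : Finset l.Partition)
    (hle : ∀ p ∈ F, A ≤ p.parts)
    (hFG : ∀ p r, p.parts = A + r.parts → (p ∈ F ↔ r ∈ G)) : F.card = G.card := by
  have pos : ∀ i ∈ A, 0 < i := fun i hi => Nat.pos_of_ne_zero fun h => hA (h ▸ hi)
  symm
  refine Finset.card_bij (fun r _ => ⟨A + r.parts, ?_, ?_⟩) ?_ ?_ ?_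
  · intro i hi
    rcases Multiset.mem_add.1 hi with h | h
    · exact pos i h
    · exact r.parts_pos h
  · rw [Multiset.sum_add, r.parts_sum, hl]
  · exact fun r hr => (hFG _ r rfl).2 hr
  · intro r _ s _ h
    ext1
    simpa using congrArg Nat.Partition.parts h
  · intro p hp
    have hsub : A + (p.parts - A) = p.parts := add_tsub_cancel_of_le (hle p hp)
    let r : l.Partition := ⟨p.parts - A,
      fun h => p.parts_pos (Multiset.mem_of_le (Multiset.sub_le_self _ _) h), by
        have h := congrArg Multiset.sum hsub
        rw [Multiset.sum_add, p.parts_sum] at h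
        omega⟩
    exact ⟨r, (hFG p r hsub.symm).1 hp, by ext1; exact hsub⟩

/-- The multiset in which `k` occurs as often as `k * m` occurs in `p`. -/
def multiplesCode (m : ℕ) {n : ℕ} (p : n.Partition) : Multiset ℕ :=
  ∑ k ∈ Finset.Icc 1 n, Multiset.replicate (p.parts.count (k * m)) k

/-- The multiset in which `k` occurs `⌊t / m⌋` times, where `t` is its multiplicity in `p`. -/
def quotientCode (m : ℕ) {n : ℕ} (p : n.Partition) : Multiset ℕ :=
  ∑ k ∈ Finset.Icc 1 n, Multiset.replicate (p.parts.count k / m) k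

theorem count_sum_replicate {s : Finset ℕ} {c : ℕ → ℕ} (hc : ∀ k ∉ s, c k = 0) (k : ℕ) :
    (∑ i ∈ s, Multiset.replicate (c i) i).count k = c k := by
  rw [Multiset.count_sum']
  simp only [Multiset.count_replicate, Finset.sum_ite_eq']
  split_ifs with h
  · rfl
  · exact (hc k h).symm

theorem count_zero {n : ℕ} (p : n.Partition) : p.parts.count 0 = 0 :=
  Multiset.count_eq_zero.2 fun h => (p.parts_pos h).ne rfl

theorem count_of_lt {n k : ℕ} (p : n.Partition) (h : n < k) : p.parts.count k = 0 :=
  Multiset.count_eq_zero.2 fun hk => (p.le_of_mem_parts hk).not_gt h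

theorem count_multiplesCode {m n : ℕ} (hm : 0 < m) (p : n.Partition) (k : ℕ) :
    (multiplesCode m p).count k = p.parts.count (k * m) := by
  refine count_sum_replicate (c := fun k => p.parts.count (k * m)) (fun k hk => ?_) k
  rcases Nat.eq_zero_or_pos k with rfl | h0
  · simpa using p.count_zero
  · refine p.count_of_lt ?_
    have : k ≤ k * m := Nat.le_mul_of_pos_right k hm
    simp only [Finset.mem_Icc] at hk
    omega

theorem count_quotientCode {m n : ℕ} (p : n.Partition) (k : ℕ) :
    (quotientCode m p).count k = p.parts.count k / m := by
  refine count_sum_replicate (c := fun k => p.parts.count k / m) (fun k hk => ?_) k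
  have : p.parts.count k = 0 := by
    rcases Nat.eq_zero_or_pos k with rfl | h0
    · exact p.count_zero
    · refine p.count_of_lt ?_
      simp only [Finset.mem_Icc] at hk
      omega
  simp [this]

theorem multiplesCode_eq_iff {m n : ℕ} (hm : 0 < m) (p : n.Partition) (C : Multiset ℕ) :
    multiplesCode m p = C ↔ ∀ k, p.parts.count (k * m) = C.count k := by
  simp only [Multiset.ext, count_multiplesCode hm]

theorem quotientCode_eq_iff {m n : ℕ} (p : n.Partition) (C : Multiset ℕ) :
    quotientCode m p = C ↔ ∀ k, p.parts.count k / m = C.count k := by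
  simp only [Multiset.ext, count_quotientCode]

theorem count_map_mul {m : ℕ} (hm : 0 < m) (C : Multiset ℕ) (k : ℕ) :
    (C.map (· * m)).count (k * m) = C.count k :=
  Multiset.count_map_eq_count' _ _ (mul_left_injective₀ hm.ne') k

theorem map_multiplesCode_le {m n : ℕ} (hm : 0 < m) (p : n.Partition) :
    (multiplesCode m p).map (· * m) ≤ p.parts := by
  rw [Multiset.le_iff_count]
  intro a
  by_cases ha : m ∣ a
  · obtain ⟨k, rfl⟩ := ha
    rw [mul_comm m k, count_map_mul hm, count_multiplesCode hm]
  · rw [Multiset.count_eq_zero.2]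
    · exact Nat.zero_le _
    · intro h
      obtain ⟨k, -, rfl⟩ := Multiset.mem_map.1 h
      exact ha (dvd_mul_left m k)

theorem nsmul_quotientCode_le {m n : ℕ} (p : n.Partition) :
    m • quotientCode m p ≤ p.parts := by
  rw [Multiset.le_iff_count]
  intro a
  rw [Multiset.count_nsmul, count_quotientCode]
  exact Nat.mul_div_le _ _

theorem card_multiplesCode_eq {m n : ℕ} (hm : 0 < m) {C : Multiset ℕ} (hC : 0 ∉ C) {l : ℕ}
    (hl : m * C.sum + l = n) :
    (Finset.univ.filter fun p : n.Partition => multiplesCode m p = C).card =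
      (restricted l (¬ m ∣ ·)).card := by
  refine card_eq_card_of_parts_eq_add (A := C.map (· * m)) ?_ ?_ _ _ ?_ ?_
  · intro h
    obtain ⟨k, hk, h0⟩ := Multiset.mem_map.1 h
    rcases Nat.mul_eq_zero.1 h0 with rfl | h0
    · exact hC hk
    · omega
  · rw [Multiset.sum_map_mul_right, Multiset.map_id', mul_comm, hl]
  · intro p hp
    rw [← (Finset.mem_filter.1 hp).2]
    exact map_multiplesCode_le hm p
  · intro p r h
    simp only [Finset.mem_filter, Finset.mem_univ, true_and, multiplesCode_eq_iff hm, restricted, h,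
      Multiset.count_add, count_map_mul hm, Nat.add_eq_left, Multiset.count_eq_zero]
    exact ⟨fun H i hi ⟨k, hk⟩ => H k (by rwa [mul_comm, ← hk]),
      fun H k hk => H _ hk (dvd_mul_left m k)⟩

theorem card_quotientCode_eq {m n : ℕ} (hm : 0 < m) {C : Multiset ℕ} (hC : 0 ∉ C) {l : ℕ}
    (hl : m * C.sum + l = n) :
    (Finset.univ.filter fun p : n.Partition => quotientCode m p = C).card =
      (countRestricted l m).card := by
  refine card_eq_card_of_parts_eq_add (A := m • C) ?_ ?_ _ _ ?_ ?_
  · exact fun h => hC (Multiset.mem_of_mem_nsmul h)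
  · rw [Multiset.sum_nsmul, smul_eq_mul, hl]
  · intro p hp
    rw [← (Finset.mem_filter.1 hp).2]
    exact nsmul_quotientCode_le p
  · intro p r h
    simp only [Finset.mem_filter, Finset.mem_univ, true_and, quotientCode_eq_iff, countRestricted, h,
      Multiset.count_add, Multiset.count_nsmul, Nat.mul_add_div hm, Nat.add_eq_left,
      Nat.div_eq_zero_iff, hm.ne', false_or]
    refine ⟨fun H i _ => H i, fun H i => ?_⟩
    by_cases hi : i ∈ r.parts
    · exact H i hi
    · rwa [Multiset.count_eq_zero.2 hi]

theorem zero_notMem_multiplesCode {m n : ℕ} (hm : 0 < m) (p : n.Partition) :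
    0 ∉ multiplesCode m p := by
  rw [← Multiset.count_eq_zero, count_multiplesCode hm, zero_mul, count_zero]

theorem zero_notMem_quotientCode {m n : ℕ} (p : n.Partition) : 0 ∉ quotientCode m p := by
  rw [← Multiset.count_eq_zero, count_quotientCode, count_zero, Nat.zero_div]

theorem sum_multiplesCode_le {m n : ℕ} (hm : 0 < m) (p : n.Partition) :
    m * (multiplesCode m p).sum ≤ n := by
  obtain ⟨r, hr⟩ := Multiset.le_iff_exists_add.1 (map_multiplesCode_le hm p)
  have h := congrArg Multiset.sum hr
  rw [p.parts_sum, Multiset.sum_add, Multiset.sum_map_mul_right, Multiset.map_id', mul_comm] at h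
  omega

theorem sum_quotientCode_le {m n : ℕ} (p : n.Partition) : m * (quotientCode m p).sum ≤ n := by
  obtain ⟨r, hr⟩ := Multiset.le_iff_exists_add.1 (nsmul_quotientCode_le (m := m) p)
  have h := congrArg Multiset.sum hr
  rw [p.parts_sum, Multiset.sum_add, Multiset.sum_nsmul, smul_eq_mul] at h
  omega

theorem card_multiplesCode_eq_card_quotientCode {m : ℕ} (hm : 0 < m) (n : ℕ) (C : Multiset ℕ) :
    (Finset.univ.filter fun p : n.Partition => multiplesCode m p = C).card =
      (Finset.univ.filter fun p : n.Partition => quotientCode m p = C).card := by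
  by_cases h : 0 ∉ C ∧ m * C.sum ≤ n
  · have hl : m * C.sum + (n - m * C.sum) = n := by omega
    rw [card_multiplesCode_eq hm h.1 hl, card_quotientCode_eq hm h.1 hl,
      card_restricted_eq_card_countRestricted _ hm]
  · rw [Finset.filter_eq_empty_iff.2, Finset.filter_eq_empty_iff.2]
    · rintro p - rfl
      exact h ⟨zero_notMem_quotientCode p, sum_quotientCode_le p⟩
    · rintro p - rfl
      exact h ⟨zero_notMem_multiplesCode hm p, sum_multiplesCode_le hm p⟩

theorem sum_mul_count {n : ℕ} (p : n.Partition) :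
    ∑ i ∈ Finset.Icc 1 n, i * p.parts.count i = n := by
  conv_rhs => rw [← p.parts_sum, Finset.sum_multiset_count_of_subset p.parts (Finset.Icc 1 n)
    fun i hi => Finset.mem_Icc.2 ⟨p.parts_pos (Multiset.mem_toFinset.1 hi),
      p.le_of_mem_parts (Multiset.mem_toFinset.1 hi)⟩]
  exact Finset.sum_congr rfl fun i _ => by rw [smul_eq_mul, mul_comm]

theorem sum_not_dvd_add_sum_mul {m n : ℕ} (hm : 0 < m) (p : n.Partition) :
    ∑ i ∈ (Finset.Icc 1 n).filter (fun i => ¬ m ∣ i), i * p.parts.count i +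
      ∑ k ∈ Finset.Icc 1 n, k * m * p.parts.count (k * m) = n := by
  rw [← Finset.sum_image (s := Finset.Icc 1 n) (g := (· * m))
    (f := fun i => i * p.parts.count i) fun a _ b _ h => mul_left_injective₀ hm.ne' h]
  conv_rhs => rw [← p.sum_mul_count,
    ← Finset.sum_filter_not_add_sum_filter (Finset.Icc 1 n) (m ∣ ·)]
  congr 1
  symm
  refine Finset.sum_subset (fun i hi => ?_) fun i hi hi' => ?_
  · obtain ⟨hi, k, rfl⟩ := Finset.mem_filter.1 hi
    rw [Finset.mem_Icc] at hi
    refine Finset.mem_image.2 ⟨k, Finset.mem_Icc.2 ⟨?_, ?_⟩, mul_comm _ _⟩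
    · exact Nat.pos_of_mul_pos_left hi.1
    · exact (Nat.le_mul_of_pos_left k hm).trans hi.2
  · obtain ⟨k, hk, rfl⟩ := Finset.mem_image.1 hi
    rw [Finset.mem_Icc] at hk
    rw [p.count_of_lt, mul_zero]
    by_contra! h
    exact hi' (Finset.mem_filter.2
      ⟨Finset.mem_Icc.2 ⟨Nat.mul_pos hk.1 hm, h⟩, dvd_mul_left m k⟩)

theorem sum_mod_add_sum_div {n : ℕ} (m : ℕ) (p : n.Partition) :
    ∑ i ∈ Finset.Icc 1 n, i * (p.parts.count i % m) +
      ∑ k ∈ Finset.Icc 1 n, k * m * (p.parts.count k / m) = n := by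
  conv_rhs => rw [← p.sum_mul_count]
  rw [← Finset.sum_add_distrib]
  exact Finset.sum_congr rfl fun i _ => by rw [mul_assoc, ← mul_add, Nat.mod_add_div]

end Nat.Partition


/-- For a positive integer `n` and an integer `m ≥ 2`, there is a bijection `σ` on the set
of partitions of `n` such that for every partition `λ` and every positive integer `k`,
`t_{km}(λ) = ⌊t_k(σ λ)/m⌋`, and `γ_m(λ) = γ'_m(σ λ)`, where
`γ_m(λ) = Σ_{m ∤ i} i·t_i(λ)` and `γ'_m(μ) = Σ_i i·(t_i(μ) % m)`.
All relevant multiplicities vanish for indices `> n`, so the sums may be taken over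
`1 ≤ i ≤ n`. -/
theorem stmt_8 (n : ℕ) (hn : 0 < n) (m : ℕ) (hm : 2 ≤ m) :
    ∃ σ : Nat.Partition n ≃ Nat.Partition n,
      (∀ p : Nat.Partition n, ∀ k : ℕ, 0 < k →
        p.parts.count (k * m) = (σ p).parts.count k / m) ∧
      (∀ p : Nat.Partition n,
        ∑ i ∈ (Finset.Icc 1 n).filter (fun i => ¬ m ∣ i), i * p.parts.count i
          = ∑ i ∈ Finset.Icc 1 n, i * ((σ p).parts.count i % m)) := by
  have hm0 : 0 < m := by omega
  let σ : Nat.Partition n ≃ Nat.Partition n :=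
    Equiv.ofFiberEquiv (f := Nat.Partition.multiplesCode m) (g := Nat.Partition.quotientCode m)
      fun C => Fintype.equivOfCardEq (by
        simpa only [Fintype.card_subtype] using
          Nat.Partition.card_multiplesCode_eq_card_quotientCode hm0 n C)
  have hσ : ∀ (p : Nat.Partition n) (k : ℕ),
      p.parts.count (k * m) = (σ p).parts.count k / m := by
    intro p k
    rw [← Nat.Partition.count_multiplesCode hm0, ← Nat.Partition.count_quotientCode]
    exact congrArg (Multiset.count k) (Equiv.ofFiberEquiv_map _ p).symm
  refine ⟨σ, fun p k _ => hσ p k, fun p => ?_⟩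
  have h₁ := p.sum_not_dvd_add_sum_mul hm0
  have h₂ := (σ p).sum_mod_add_sum_div m
  simp only [hσ] at h₁
  omega
end

section
/- Let m, n, and k be positive integers and let x be a real number. Then Σ_{λ ∈ P(n)} t_{km}(λ) · x^{α_m(λ)} = Σ_{λ ∈ P(n)} ⌊t_k(λ)/m⌋ · x^{α'_m(λ)}, where both sums run over all partitions λ of n, α_m(λ) = Σ_{j≥1} t_{jm}(λ) and α'_m(λ) = Σ_{j≥1} ⌊t_j(λ)/m⌋. -/
namespace Nat.Partition

/-- Partitions of `n` containing a multiset `b` of positive integers correspond to partitions of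
`n - b.sum`, by removing `b`. -/
def containingEquiv {n : ℕ} {b : Multiset ℕ} (hb : 0 ∉ b) (hbn : b.sum ≤ n)
    (S : Multiset ℕ → Prop) :
    {p : n.Partition // b ≤ p.parts ∧ S (p.parts - b)} ≃
      {q : (n - b.sum).Partition // S q.parts} where
  toFun p := ⟨⟨p.1.parts - b, fun hi => p.1.parts_pos (Multiset.mem_of_le tsub_le_self hi), by
    have h := congrArg Multiset.sum (tsub_add_cancel_of_le p.2.1)
    rw [Multiset.sum_add, p.1.parts_sum] at h
    omega⟩, p.2.2⟩
  invFun q := ⟨⟨q.1.parts + b, fun {i} hi => by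
    rcases Multiset.mem_add.1 hi with hi | hi
    · exact q.1.parts_pos hi
    · exact Nat.pos_of_ne_zero fun h => hb (h ▸ hi), by
    rw [Multiset.sum_add, q.1.parts_sum]
    omega⟩, by simp, by simpa using q.2⟩
  left_inv p := Subtype.ext (Nat.Partition.ext (tsub_add_cancel_of_le p.2.1))
  right_inv q := Subtype.ext (Nat.Partition.ext (add_tsub_cancel_right _ _))

/-- The multiset in which `j` occurs as often as `j * m` does in `s`. -/
noncomputable def contract (m : ℕ) (hm : 0 < m) (s : Multiset ℕ) : Multiset ℕ :=
  Finsupp.toMultiset (Finsupp.comapDomain (· * m) (Multiset.toFinsupp s)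
    (mul_left_injective₀ hm.ne').injOn)

/-- The multiset in which `j` occurs `⌊t / m⌋` times if it occurs `t` times in `s`. -/
noncomputable def quotient (m : ℕ) (s : Multiset ℕ) : Multiset ℕ :=
  Finsupp.toMultiset (Finsupp.mapRange (· / m) (Nat.zero_div m) (Multiset.toFinsupp s))

lemma count_contract {m : ℕ} (hm : 0 < m) (s : Multiset ℕ) (j : ℕ) :
    (contract m hm s).count j = s.count (j * m) := by
  simp [contract, Finsupp.count_toMultiset]

lemma count_quotient (m : ℕ) (s : Multiset ℕ) (j : ℕ) :
    (quotient m s).count j = s.count j / m := by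
  simp [quotient, Finsupp.count_toMultiset]

lemma contract_eq_iff {m : ℕ} (hm : 0 < m) (s t : Multiset ℕ) :
    contract m hm s = t ↔
      t.map (· * m) ≤ s ∧ ∀ i ∈ s - t.map (· * m), ¬ m ∣ i := by
  have hinj := mul_left_injective₀ hm.ne'
  have hc (j : ℕ) : (t.map (· * m)).count (j * m) = t.count j :=
    Multiset.count_map_eq_count' _ t hinj j
  constructor
  · rintro rfl
    refine ⟨Multiset.le_iff_count.2 fun i => ?_, ?_⟩
    · by_cases hi : m ∣ i
      · obtain ⟨j, rfl⟩ := hi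
        rw [mul_comm m j, hc, count_contract]
      · rw [Multiset.count_eq_zero.2]
        · exact Nat.zero_le _
        · rintro h
          obtain ⟨j, -, rfl⟩ := Multiset.mem_map.1 h
          exact hi (dvd_mul_left m j)
    · rintro _ hi ⟨j, rfl⟩
      rw [← Multiset.count_pos, mul_comm m j, Multiset.count_sub, hc, count_contract] at hi
      omega
  · rintro ⟨hle, h⟩
    ext j
    have h1 := Multiset.le_iff_count.1 hle (j * m)
    have h2 := Multiset.count_eq_zero.2 fun hj => h (j * m) hj (dvd_mul_left m j)
    rw [Multiset.count_sub] at h2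
    rw [hc] at h1 h2
    rw [count_contract]
    omega

lemma quotient_eq_iff {m : ℕ} (hm : 0 < m) (s t : Multiset ℕ) :
    quotient m s = t ↔ m • t ≤ s ∧ ∀ i ∈ s - m • t, (s - m • t).count i < m := by
  constructor
  · rintro rfl
    refine ⟨Multiset.le_iff_count.2 fun i => ?_, fun i _ => ?_⟩
    · rw [Multiset.count_nsmul, count_quotient]
      exact Nat.mul_div_le _ _
    · rw [Multiset.count_sub, Multiset.count_nsmul, count_quotient, ← Nat.mod_eq_sub]
      exact Nat.mod_lt _ hm
  · rintro ⟨hle, h⟩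
    ext j
    have h1 := Multiset.le_iff_count.1 hle j
    have h2 : (s - m • t).count j < m := by
      by_cases hj : j ∈ s - m • t
      · exact h j hj
      · rwa [Multiset.count_eq_zero.2 hj]
    rw [Multiset.count_sub] at h2
    rw [Multiset.count_nsmul] at h1 h2
    rw [count_quotient, Nat.div_eq_iff hm]
    rw [mul_comm m] at h1 h2
    constructor <;> omega

/-- The fibres of `contract` and `quotient` are equinumerous, by Glaisher's theorem. -/
lemma nonempty_contract_fiber_equiv_quotient_fiber (n : ℕ) {m : ℕ} (hm : 0 < m)
    (t : Multiset ℕ) :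
    Nonempty ({p : n.Partition // contract m hm p.parts = t} ≃
      {p : n.Partition // quotient m p.parts = t}) := by
  simp only [contract_eq_iff, quotient_eq_iff hm]
  have hsum : (t.map (· * m)).sum = (m • t).sum := by
    rw [Multiset.sum_map_mul_right, Multiset.map_id', Multiset.sum_nsmul, smul_eq_mul, mul_comm]
  by_cases h : 0 ∉ t ∧ (m • t).sum ≤ n
  · have h1 : 0 ∉ t.map (· * m) := by simpa [hm.ne'] using h.1
    have h2 : 0 ∉ m • t := fun h' => h.1 (Multiset.mem_of_mem_nsmul h')
    have hG := card_restricted_eq_card_countRestricted (n - (m • t).sum) hm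
    have e1 := containingEquiv h1 (hsum.trans_le h.2) fun s => ∀ i ∈ s, ¬ m ∣ i
    have e2 := containingEquiv h2 h.2 fun s => ∀ i ∈ s, s.count i < m
    rw [hsum] at e1
    refine ⟨e1.trans (Equiv.trans ?_ e2.symm)⟩
    refine Fintype.equivOfCardEq ?_
    rw [Fintype.card_subtype, Fintype.card_subtype]
    exact hG
  · have key (b : Multiset ℕ) (hb : 0 ∈ t → 0 ∈ b) (hbs : b.sum = (m • t).sum)
        (p : n.Partition) : ¬ b ≤ p.parts := by
      intro hle
      refine h ⟨fun h0 => ?_, ?_⟩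
      · exact (p.parts_pos (Multiset.mem_of_le hle (hb h0))).false
      · obtain ⟨u, hu⟩ := Multiset.le_iff_exists_add.1 hle
        rw [← hbs, ← p.parts_sum, hu, Multiset.sum_add]
        exact Nat.le_add_right _ _
    have k1 := key (t.map (· * m)) (fun h0 => Multiset.mem_map.2 ⟨0, h0, zero_mul m⟩) hsum
    have k2 := key (m • t) (fun h0 => Multiset.mem_nsmul.2 ⟨hm.ne', h0⟩) rfl
    have : IsEmpty {p : n.Partition // t.map (· * m) ≤ p.parts ∧
        ∀ i ∈ p.parts - t.map (· * m), ¬ m ∣ i} := ⟨fun p => k1 p.1 p.2.1⟩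
    have : IsEmpty {p : n.Partition // m • t ≤ p.parts ∧
        ∀ i ∈ p.parts - m • t, (p.parts - m • t).count i < m} := ⟨fun p => k2 p.1 p.2.1⟩
    exact ⟨Equiv.equivOfIsEmpty _ _⟩

/-- A permutation of the partitions of `n` taking `contract` to `quotient`. -/
lemma exists_equiv_quotient_eq_contract (n : ℕ) {m : ℕ} (hm : 0 < m) :
    ∃ e : n.Partition ≃ n.Partition, ∀ p, quotient m (e p).parts = contract m hm p.parts :=
  ⟨Equiv.ofFiberEquiv fun t => (nonempty_contract_fiber_equiv_quotient_fiber n hm t).some,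
    fun p => Equiv.ofFiberEquiv_map (g := fun q : n.Partition => quotient m q.parts) _ p⟩

end Nat.Partition

/-- For positive integers `m`, `n`, `k` and a real number `x`:
`Σ_{λ} t_{km}(λ) x^(α_m(λ)) = Σ_{λ} ⌊t_k(λ)/m⌋ x^(α'_m(λ))`, where
`α_m(λ) = Σ_{j≥1} t_{jm}(λ)` and `α'_m(λ) = Σ_{j≥1} ⌊t_j(λ)/m⌋`.
All terms with index `> n` vanish, so the inner sums may be taken over `1 ≤ j ≤ n`. -/
theorem stmt_9 (m n k : ℕ) (hm : 0 < m) (hn : 0 < n) (hk : 0 < k) (x : ℝ) :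
    ∑ p : Nat.Partition n,
        (p.parts.count (k * m) : ℝ) * x ^ (∑ j ∈ Finset.Icc 1 n, p.parts.count (j * m))
      = ∑ p : Nat.Partition n,
        ((p.parts.count k / m : ℕ) : ℝ) * x ^ (∑ j ∈ Finset.Icc 1 n, p.parts.count j / m) := by
  obtain ⟨e, he⟩ := Nat.Partition.exists_equiv_quotient_eq_contract n hm
  refine Fintype.sum_equiv e _ _ fun p => ?_
  simp only [← Nat.Partition.count_quotient, ← Nat.Partition.count_contract hm, he]
end

section
/- Let m, n, and k be positive integers. Then Σ_{λ ∈ P(n)} t_{km}(λ) = Σ_{λ ∈ P(n)} ⌊t_k(λ)/m⌋, where both sums run over all partitions λ of n. -/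
namespace Nat.Partition

variable {n : ℕ}

/-- Replace the sub-multiset `s` of the parts of a partition by `t`, which has the same sum. -/
def exchange (p : Partition n) {s t : Multiset ℕ} (hs : s ≤ p.parts) (ht : ∀ i ∈ t, 0 < i)
    (hst : s.sum = t.sum) : Partition n where
  parts := p.parts - s + t
  parts_pos {i} hi := by
    rcases Multiset.mem_add.1 hi with h | h
    · exact p.parts_pos (Multiset.mem_of_le (Multiset.sub_le_self _ _) h)
    · exact ht i h
  parts_sum := by
    rw [Multiset.sum_add, ← hst, ← Multiset.sum_add, tsub_add_cancel_of_le hs, p.parts_sum]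

/-- The number of partitions of `n` containing a given multiset of positive parts depends only on
the sum of this multiset. -/
theorem card_filter_le_parts_congr {s t : Multiset ℕ} (hs : ∀ i ∈ s, 0 < i) (ht : ∀ i ∈ t, 0 < i)
    (hst : s.sum = t.sum) :
    (Finset.univ.filter fun p : Partition n => s ≤ p.parts).card =
      (Finset.univ.filter fun p : Partition n => t ≤ p.parts).card := by
  refine Finset.card_bij' (fun p hp => p.exchange (Finset.mem_filter.1 hp).2 ht hst)
    (fun p hp => p.exchange (Finset.mem_filter.1 hp).2 hs hst.symm) ?_ ?_ ?_ ?_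
  · intro p hp
    exact Finset.mem_filter.2 ⟨Finset.mem_univ _, Multiset.le_add_left _ _⟩
  · intro p hp
    exact Finset.mem_filter.2 ⟨Finset.mem_univ _, Multiset.le_add_left _ _⟩
  · intro p hp
    ext1
    simp [exchange, tsub_add_cancel_of_le (Finset.mem_filter.1 hp).2]
  · intro p hp
    ext1
    simp [exchange, tsub_add_cancel_of_le (Finset.mem_filter.1 hp).2]

theorem count_parts_le_s10 (p : Partition n) (a : ℕ) : p.parts.count a ≤ n := by
  calc p.parts.count a ≤ p.parts.card := Multiset.count_le_card _ _
    _ ≤ p.parts.sum := by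
      simpa using Multiset.card_nsmul_le_sum (a := 1) fun i hi => p.parts_pos hi
    _ = n := p.parts_sum

end Nat.Partition

/-- Layer-cake formula for a finite sum of bounded natural numbers. -/
theorem Finset.sum_eq_sum_card_filter_le {α : Type*} (s : Finset α) (f : α → ℕ) {N : ℕ}
    (hf : ∀ x ∈ s, f x ≤ N) :
    ∑ x ∈ s, f x = ∑ j ∈ Finset.Icc 1 N, (s.filter fun x => j ≤ f x).card := by
  simp_rw [Finset.card_filter]
  rw [Finset.sum_comm]
  refine Finset.sum_congr rfl fun x hx => ?_
  have h : (Finset.Icc 1 N).filter (fun j => j ≤ f x) = Finset.Icc 1 (f x) := by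
    ext j
    have := hf x hx
    simp only [Finset.mem_filter, Finset.mem_Icc]
    omega
  rw [← Finset.card_filter, h, Nat.card_Icc, Nat.add_sub_cancel]

/-- For positive integers `m`, `n`, `k`:
`Σ_{λ ∈ P(n)} t_{km}(λ) = Σ_{λ ∈ P(n)} ⌊t_k(λ)/m⌋`. -/
theorem stmt_10 (m n k : ℕ) (hm : 0 < m) (hn : 0 < n) (hk : 0 < k) :
    ∑ p : Nat.Partition n, p.parts.count (k * m)
      = ∑ p : Nat.Partition n, p.parts.count k / m := by
  rw [Finset.sum_eq_sum_card_filter_le _ _ fun p _ => p.count_parts_le_s10 (k * m),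
    Finset.sum_eq_sum_card_filter_le _ _ fun p _ =>
      (Nat.div_le_self _ m).trans (p.count_parts_le_s10 k)]
  refine Finset.sum_congr rfl fun j _ => ?_
  simp_rw [Nat.le_div_iff_mul_le hm, Multiset.le_count_iff_replicate_le]
  refine Nat.Partition.card_filter_le_parts_congr (fun i hi => ?_) (fun i hi => ?_) ?_
  · rw [Multiset.eq_of_mem_replicate hi]
    exact Nat.mul_pos hk hm
  · rwa [Multiset.eq_of_mem_replicate hi]
  · simp only [Multiset.sum_replicate, smul_eq_mul]
    ring
end

section
/- Let m and n be positive integers and let x, y, z be real numbers. Then Σ_{λ ∈ P(n)} x^{α_m(λ)} y^{β_m(λ)} z^{γ_m(λ)} = Σ_{λ ∈ P(n)} x^{α'_m(λ)} y^{β'_m(λ)} z^{γ'_m(λ)}, where both sums run over all partitions λ of n, α_m(λ) = Σ_{k≥1} t_{km}(λ), β_m(λ) = Σ_{k≥1} k·t_{km}(λ), γ_m(λ) = Σ_{i : m ∤ i} i·t_i(λ), α'_m(λ) = Σ_{k≥1} ⌊t_k(λ)/m⌋, β'_m(λ) = Σ_{k≥1} k·⌊t_k(λ)/m⌋, and γ'_m(λ)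 = Σ_{i≥1} i·⟨t_i(λ)⟩_m. -/
lemma Multiset.card_eq_sum_Icc_count {s : Multiset ℕ} {n : ℕ} (hs : ∀ i ∈ s, 0 < i)
    (hn : s.sum ≤ n) : s.card = ∑ i ∈ Finset.Icc 1 n, s.count i :=
  (Multiset.sum_count_eq_card fun i hi ↦ Finset.mem_Icc.2
    ⟨hs i hi, (Multiset.le_sum_of_mem hi).trans hn⟩).symm

lemma Multiset.sum_eq_sum_Icc_mul_count_s13 {s : Multiset ℕ} {n : ℕ} (hn : s.sum ≤ n) :
    s.sum = ∑ i ∈ Finset.Icc 1 n, i * s.count i := by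
  have h : s.toFinset ⊆ Finset.range (n + 1) := fun i hi ↦ Finset.mem_range.2
    (Nat.lt_succ_of_le ((Multiset.le_sum_of_mem (Multiset.mem_toFinset.1 hi)).trans hn))
  rw [Finset.sum_multiset_count_of_subset _ _ h, Finset.range_eq_Ico,
    Finset.sum_eq_sum_Ico_succ_bot (Nat.succ_pos n)]
  simp [mul_comm, Finset.Ico_add_one_right_eq_Icc]

open Finset in
/-- If every multiset `s` decomposes uniquely as `c (A s) + B s` with `B s` satisfying `Q`, and `c`
multiplies sums by `m`, then a sum over partitions of `n` is determined by the numbers of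
partitions satisfying `Q`. -/
lemma sum_partition_eq_of_decomposition_s13 {M : Type*} [AddCommMonoid M] {m : ℕ} (hm : 0 < m) (n : ℕ)
    (F : ℕ → ℕ → ℕ → M) (Q : Multiset ℕ → Prop) [DecidablePred Q]
    (c A B : Multiset ℕ → Multiset ℕ)
    (hsum : ∀ μ, (c μ).sum = m * μ.sum)
    (hc : ∀ μ, (∀ i ∈ μ, 0 < i) → ∀ i ∈ c μ, 0 < i)
    (hA : ∀ μ, (∀ i ∈ μ, 0 < i) → ∀ i ∈ A μ, 0 < i)
    (hrec : ∀ s, c (A s) + B s = s) (hQ : ∀ s, Q (B s))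
    (hinv : ∀ μ ν, Q ν → A (c μ + ν) = μ) :
    ∑ p : n.Partition, F (∑ k ∈ Icc 1 n, (A p.parts).count k)
        (∑ k ∈ Icc 1 n, k * (A p.parts).count k) (∑ k ∈ Icc 1 n, k * (B p.parts).count k) =
      ∑ a ∈ range (n / m + 1), ∑ μ : a.Partition,
        #{ν : (n - m * a).Partition | Q ν.parts} • F μ.parts.card a (n - m * a) := by
  have hB : ∀ μ ν, Q ν → B (c μ + ν) = ν := fun μ ν h ↦ by
    have := hrec (c μ + ν)
    rwa [hinv μ ν h, add_right_inj] at this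
  have hn : ∀ s : Multiset ℕ, m * (A s).sum + (B s).sum = s.sum := fun s ↦ by
    rw [← hsum, ← Multiset.sum_add, hrec]
  trans ∑ p : n.Partition, F (A p.parts).card (A p.parts).sum (B p.parts).sum
  · refine sum_congr rfl fun p _ ↦ ?_
    have hp := hn p.parts
    rw [p.parts_sum] at hp
    have hle : (A p.parts).sum ≤ n :=
      (Nat.le_mul_of_pos_left _ hm).trans (Nat.le.intro hp)
    rw [← Multiset.card_eq_sum_Icc_count (hA _ fun _ ↦ p.parts_pos) hle,
      ← Multiset.sum_eq_sum_Icc_mul_count_s13 hle, ← Multiset.sum_eq_sum_Icc_mul_count_s13 (by omega)]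
  simp_rw [← sum_const, sum_sigma']
  symm
  refine sum_bij (fun q hq ↦ ⟨c q.2.1.parts + q.2.2.parts, ?_, ?_⟩) ?_ ?_ ?_ ?_
  · intro i hi
    rcases Multiset.mem_add.1 hi with h | h
    · exact hc _ (fun _ ↦ q.2.1.parts_pos) i h
    · exact q.2.2.parts_pos h
  · simp only [mem_sigma, mem_range, Nat.lt_succ_iff, Nat.le_div_iff_mul_le hm] at hq
    rw [Multiset.sum_add, hsum, q.2.1.parts_sum, q.2.2.parts_sum, Nat.add_sub_cancel']
    rw [mul_comm]
    exact hq.1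
  · simp
  · rintro ⟨a, μ, ν⟩ h ⟨a', μ', ν'⟩ h' he
    simp only [mem_sigma, mem_filter, mem_univ, true_and] at h h'
    simp only [Nat.Partition.mk.injEq] at he
    have hμ : μ.parts = μ'.parts := by rw [← hinv μ.parts _ h.2, he, hinv _ _ h'.2]
    have hν : ν.parts = ν'.parts := by rw [← hB _ ν.parts h.2, he, hB _ _ h'.2]
    obtain rfl : a = a' := by rw [← μ.parts_sum, ← μ'.parts_sum, hμ]
    obtain rfl := Nat.Partition.ext hμ
    obtain rfl := Nat.Partition.ext hν
    rfl
  · intro p _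
    have hp := hn p.parts
    rw [p.parts_sum] at hp
    refine ⟨⟨(A p.parts).sum, ⟨A p.parts, fun h ↦ hA _ (fun _ ↦ p.parts_pos) _ h, rfl⟩,
      ⟨B p.parts, fun {i} h ↦ p.parts_pos ?_, by omega⟩⟩, ?_, ?_⟩
    · rw [← hrec p.parts]
      exact Multiset.mem_add.2 (Or.inr h)
    · simp only [mem_sigma, mem_range, Nat.lt_succ_iff, Nat.le_div_iff_mul_le hm, mem_filter,
        mem_univ, true_and]
      exact ⟨by rw [mul_comm]; omega, hQ _⟩
    · exact Nat.Partition.ext (hrec _)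
  · rintro ⟨a, μ, ν⟩ h
    simp only [mem_sigma, mem_filter, mem_univ, true_and] at h
    simp only [hinv _ _ h.2, hB _ _ h.2, μ.parts_sum, ν.parts_sum]

/-- The multiset in which the multiplicity of `i` is `f` of its multiplicity in `s`. -/
def Multiset.mapCount (f : ℕ → ℕ) (s : Multiset ℕ) : Multiset ℕ :=
  ∑ i ∈ s.toFinset, Multiset.replicate (f (s.count i)) i

lemma Multiset.count_mapCount {f : ℕ → ℕ} (hf : f 0 = 0) (s : Multiset ℕ) (i : ℕ) :
    (s.mapCount f).count i = f (s.count i) := by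
  simp only [mapCount, Multiset.count_sum', Multiset.count_replicate, Finset.sum_ite_eq',
    Multiset.mem_toFinset]
  split_ifs with h
  · rfl
  · rw [Multiset.count_eq_zero_of_notMem h, hf]

lemma Multiset.mem_of_mem_mapCount {f : ℕ → ℕ} {s : Multiset ℕ} {i : ℕ}
    (h : i ∈ s.mapCount f) : i ∈ s := by
  obtain ⟨j, hj, hi⟩ := Multiset.mem_sum.1 h
  rw [Multiset.eq_of_mem_replicate hi]
  exact Multiset.mem_toFinset.1 hj

/-- For positive integers `m`, `n` and real numbers `x`, `y`, `z`:
`Σ_{λ} x^(α_m) y^(β_m) z^(γ_m) = Σ_{λ} x^(α'_m) y^(β'_m) z^(γ'_m)`, where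
`α_m = Σ_k t_{km}`, `β_m = Σ_k k·t_{km}`, `γ_m = Σ_{m ∤ i} i·t_i`,
`α'_m = Σ_k ⌊t_k/m⌋`, `β'_m = Σ_k k·⌊t_k/m⌋`, `γ'_m = Σ_i i·(t_i % m)`.
All terms with index `> n` vanish, so the sums may be taken over `1 ≤ i ≤ n`. -/
theorem stmt_13 (m n : ℕ) (hm : 0 < m) (hn : 0 < n) (x y z : ℝ) :
    ∑ p : Nat.Partition n,
        x ^ (∑ k ∈ Finset.Icc 1 n, p.parts.count (k * m)) *
        y ^ (∑ k ∈ Finset.Icc 1 n, k * p.parts.count (k * m)) *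
        z ^ (∑ i ∈ (Finset.Icc 1 n).filter (fun i => ¬ m ∣ i), i * p.parts.count i)
      = ∑ p : Nat.Partition n,
        x ^ (∑ k ∈ Finset.Icc 1 n, p.parts.count k / m) *
        y ^ (∑ k ∈ Finset.Icc 1 n, k * (p.parts.count k / m)) *
        z ^ (∑ i ∈ Finset.Icc 1 n, i * (p.parts.count i % m)) := by
  have hmap (s : Multiset ℕ) :
      ((s.filter (m ∣ ·)).map (· / m)).map (· * m) = s.filter (m ∣ ·) := by
    rw [Multiset.map_map]
    exact (Multiset.map_congr rfl fun i hi ↦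
      Nat.div_mul_cancel (Multiset.mem_filter.1 hi).2).trans (Multiset.map_id _)
  have sum_eq_of_dvd (F : ℕ → ℕ → ℕ → ℝ) := sum_partition_eq_of_decomposition_s13 hm n F
    (fun s ↦ ∀ i ∈ s, ¬ m ∣ i) (fun s ↦ s.map (· * m))
    (fun s ↦ (s.filter (m ∣ ·)).map (· / m)) (fun s ↦ s.filter (¬ m ∣ ·))
    (fun μ ↦ by rw [Multiset.sum_map_mul_right, Multiset.map_id', mul_comm])
    (fun μ h i hi ↦ by
      obtain ⟨j, hj, rfl⟩ := Multiset.mem_map.1 hi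
      exact Nat.mul_pos (h j hj) hm)
    (fun μ h i hi ↦ by
      obtain ⟨j, hj, rfl⟩ := Multiset.mem_map.1 hi
      rw [Multiset.mem_filter] at hj
      exact Nat.div_pos (Nat.le_of_dvd (h j hj.1) hj.2) hm)
    (fun s ↦ by rw [hmap, Multiset.filter_add_not])
    (fun s i hi ↦ (Multiset.mem_filter.1 hi).2)
    (fun μ ν h ↦ by
      rw [Multiset.filter_add, Multiset.filter_eq_nil.2 h, add_zero, Multiset.filter_eq_self.2,
        Multiset.map_map]
      · simp [hm]
      · simp)
  have sum_eq_of_count (F : ℕ → ℕ → ℕ → ℝ) := sum_partition_eq_of_decomposition_s13 hm n F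
    (fun s ↦ ∀ i ∈ s, s.count i < m) (fun s ↦ m • s)
    (Multiset.mapCount (· / m)) (Multiset.mapCount (· % m))
    (fun μ ↦ by rw [Multiset.sum_nsmul, smul_eq_mul])
    (fun μ h i hi ↦ h i (Multiset.mem_of_mem_nsmul hi))
    (fun μ h i hi ↦ h i (Multiset.mem_of_mem_mapCount hi))
    (fun s ↦ by
      ext i
      rw [Multiset.count_add, Multiset.count_nsmul, Multiset.count_mapCount (Nat.zero_div m),
        Multiset.count_mapCount (Nat.zero_mod m), Nat.div_add_mod])
    (fun s i hi ↦ by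
      rw [Multiset.count_mapCount (Nat.zero_mod m)]
      exact Nat.mod_lt _ hm)
    (fun μ ν h ↦ by
      ext i
      have hi : ν.count i < m := by
        by_cases hi : i ∈ ν
        · exact h i hi
        · rwa [Multiset.count_eq_zero_of_notMem hi]
      simp [Multiset.count_mapCount, Nat.mul_add_div hm, Nat.div_eq_of_lt hi])
  have hcount (s : Multiset ℕ) (k : ℕ) :
      ((s.filter (m ∣ ·)).map (· / m)).count k = s.count (k * m) := by
    rw [← Multiset.count_map_eq_count' (· * m) _ (mul_left_injective₀ hm.ne') k, hmap,
      Multiset.count_filter_of_pos (Nat.dvd_mul_left m k)]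
  have hcard (k : ℕ) : Finset.card {ν : k.Partition | ∀ i ∈ ν.parts, ¬ m ∣ i} =
      Finset.card {ν : k.Partition | ∀ i ∈ ν.parts, ν.parts.count i < m} :=
    Nat.Partition.card_restricted_eq_card_countRestricted k hm
  have hE := (sum_eq_of_dvd fun a b c ↦ x ^ a * y ^ b * z ^ c).trans
    (.trans (by simp_rw [hcard]) (sum_eq_of_count fun a b c ↦ x ^ a * y ^ b * z ^ c).symm)
  simp_rw [hcount, Multiset.count_mapCount (f := (· / m)) (Nat.zero_div m),
    Multiset.count_mapCount (f := (· % m)) (Nat.zero_mod m), Multiset.count_filter, mul_ite,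
    mul_zero, ← Finset.sum_filter] at hE
  exact hE
end

section
/- Let n and j be positive integers with j ≤ n, and let p denote the partition function with p(0) = 1. The total number of times the part j appears across all partitions of n, counted with multiplicity (that is, Σ_{λ ∈ P(n)} t_j(λ)), equals Σ_{l=1}^{⌊n/j⌋} p(n - l·j). -/
/-- Removing `l` copies of the part `j` identifies the partitions of `n` in which `j` occurs
at least `l` times with the partitions of `n - l * j`. -/
def Nat.Partition.subtypeLeCountEquiv {n j l : ℕ} (hj : 0 < j) (hl : l * j ≤ n) :
    {p : Nat.Partition n // l ≤ p.parts.count j} ≃ Nat.Partition (n - l * j) where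
  toFun p :=
    { parts := p.1.parts - Multiset.replicate l j
      parts_pos := fun h => p.1.parts_pos (Multiset.mem_of_le (Multiset.sub_le_self _ _) h)
      parts_sum := by
        have h := congrArg Multiset.sum
          (tsub_add_cancel_of_le (Multiset.le_count_iff_replicate_le.mp p.2))
        rw [Multiset.sum_add, Multiset.sum_replicate, p.1.parts_sum, smul_eq_mul] at h
        omega }
  invFun q :=
    ⟨{ parts := q.parts + Multiset.replicate l j
       parts_pos := fun h => by
        rcases Multiset.mem_add.mp h with h | h
        · exact q.parts_pos h
        · rwa [Multiset.eq_of_mem_replicate h]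
       parts_sum := by
        rw [Multiset.sum_add, Multiset.sum_replicate, q.parts_sum, smul_eq_mul]
        omega }, by simp⟩
  left_inv p := Subtype.ext <| Nat.Partition.ext <|
    tsub_add_cancel_of_le (Multiset.le_count_iff_replicate_le.mp p.2)
  right_inv q := Nat.Partition.ext <| add_tsub_cancel_right _ _

theorem Nat.Partition.count_parts_le_div {n j : ℕ} (hj : 0 < j) (p : Nat.Partition n) :
    p.parts.count j ≤ n / j := by
  rw [Nat.le_div_iff_mul_le hj]
  have h := congrArg Multiset.sum
    (tsub_add_cancel_of_le (Multiset.le_count_iff_replicate_le.mp (le_refl (p.parts.count j))))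
  rw [Multiset.sum_add, Multiset.sum_replicate, p.parts_sum, smul_eq_mul] at h
  omega

/-- For positive integers `n`, `j` with `j ≤ n`, the total number of times the part `j`
appears across all partitions of `n` equals `Σ_{l=1}^{⌊n/j⌋} p(n - lj)`. -/
theorem stmt_17 (n j : ℕ) (hn : 0 < n) (hj : 0 < j) (hjn : j ≤ n) :
    ∑ p : Nat.Partition n, p.parts.count j
      = ∑ l ∈ Finset.Icc 1 (n / j), Fintype.card (Nat.Partition (n - l * j)) := by
  have count_eq (p : Nat.Partition n) :
      p.parts.count j = ∑ l ∈ Finset.Icc 1 (n / j), if l ≤ p.parts.count j then 1 else 0 := by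
    have filter_eq : (Finset.Icc 1 (n / j)).filter (· ≤ p.parts.count j)
        = Finset.Icc 1 (p.parts.count j) := by
      ext l
      have := p.count_parts_le_div hj
      simp only [Finset.mem_filter, Finset.mem_Icc]
      omega
    rw [← Finset.card_filter, filter_eq, Nat.card_Icc, Nat.add_sub_cancel]
  rw [Finset.sum_congr rfl fun p _ => count_eq p, Finset.sum_comm]
  refine Finset.sum_congr rfl fun l hl => ?_
  have hln : l * j ≤ n := (Nat.le_div_iff_mul_le hj).mp (Finset.mem_Icc.mp hl).2
  rw [← Finset.card_filter, ← Fintype.card_subtype]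
  exact Fintype.card_congr (Nat.Partition.subtypeLeCountEquiv hj hln)
end

section
/- Let n be a positive integer and let m ≥ 2 be an integer. The number of partitions of n in which no part is a multiple of m equals the number of partitions of n in which every part appears fewer than m times. -/
/-- Glaisher's theorem: for a positive integer `n` and an integer `m ≥ 2`, the number of
partitions of `n` with no part a multiple of `m` equals the number of partitions of `n`
in which every part appears fewer than `m` times. -/
theorem stmt_18 (n : ℕ) (hn : 0 < n) (m : ℕ) (hm : 2 ≤ m) :
    Nat.card {p : Nat.Partition n // ∀ i ∈ p.parts, ¬ m ∣ i}
      = Nat.card {p : Nat.Partition n // ∀ i ∈ p.parts, p.parts.count i < m} := by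
  classical
  simpa only [Nat.card_eq_fintype_card, Fintype.card_subtype, Nat.Partition.restricted,
    Nat.Partition.countRestricted] using
    Nat.Partition.card_restricted_eq_card_countRestricted n (Nat.zero_lt_of_lt hm)
end

section
/- Let n be a positive integer and let m ≥ 2 be an integer. The number of partitions of n in which every part is a multiple of m equals the number of partitions of n in which the multiplicity of every part is a multiple of m. -/
namespace Nat.Partition

/-- Replace every part `i`, assumed to be a multiple of `m`, by `m` copies of `i / m`. -/
def splitParts {n m : ℕ} (hm : 0 < m) (p : Nat.Partition n) (hp : ∀ i ∈ p.parts, m ∣ i) :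
    Nat.Partition n where
  parts := m • p.parts.map (· / m)
  parts_pos {i} hi := by
    obtain ⟨j, hj, rfl⟩ := Multiset.mem_map.1 (Multiset.mem_of_mem_nsmul hi)
    exact Nat.div_pos (Nat.le_of_dvd (p.parts_pos hj) (hp j hj)) hm
  parts_sum := by
    rw [Multiset.sum_nsmul, smul_eq_mul, ← Multiset.sum_map_mul_left,
      Multiset.map_congr rfl fun i hi => Nat.mul_div_cancel' (hp i hi), Multiset.map_id',
      p.parts_sum]

theorem dvd_count_splitParts {n m : ℕ} (hm : 0 < m) (p : Nat.Partition n)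
    (hp : ∀ i ∈ p.parts, m ∣ i) (i : ℕ) : m ∣ (p.splitParts hm hp).parts.count i := by
  simp [splitParts, Multiset.count_nsmul]

theorem eq_of_splitParts_eq {n m : ℕ} (hm : 0 < m) {p q : Nat.Partition n}
    (hp : ∀ i ∈ p.parts, m ∣ i) (hq : ∀ i ∈ q.parts, m ∣ i)
    (h : p.splitParts hm hp = q.splitParts hm hq) : p = q := by
  have hdiv : p.parts.map (· / m) = q.parts.map (· / m) := by
    ext i
    have hi := congrArg (fun r : Nat.Partition n => r.parts.count i) h
    simp only [splitParts, Multiset.count_nsmul] at hi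
    exact Nat.eq_of_mul_eq_mul_left hm hi
  have hmul (r : Nat.Partition n) (hr : ∀ i ∈ r.parts, m ∣ i) :
      (r.parts.map (· / m)).map (m * ·) = r.parts := by
    rw [Multiset.map_map]
    exact (Multiset.map_congr rfl fun i hi => Nat.mul_div_cancel' (hr i hi)).trans
      (Multiset.map_id' _)
  exact Nat.Partition.ext (by rw [← hmul p hp, ← hmul q hq, hdiv])

theorem exists_splitParts_eq {n m : ℕ} (hm : 0 < m) (q : Nat.Partition n)
    (hq : ∀ i ∈ q.parts, m ∣ q.parts.count i) :
    ∃ (p : Nat.Partition n) (hp : ∀ i ∈ p.parts, m ∣ i), p.splitParts hm hp = q := by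
  obtain ⟨s, hs⟩ := Multiset.exists_smul_of_dvd_count q.parts hq
  refine ⟨⟨s.map (m * ·), ?_, ?_⟩, ?_, ?_⟩
  · intro i hi
    obtain ⟨j, hj, rfl⟩ := Multiset.mem_map.1 hi
    refine Nat.mul_pos hm (q.parts_pos ?_)
    rw [hs]
    exact (Multiset.mem_nsmul_of_ne_zero hm.ne').2 hj
  · rw [Multiset.sum_map_mul_left, Multiset.map_id', ← smul_eq_mul, ← Multiset.sum_nsmul, ← hs,
      q.parts_sum]
  · intro i hi
    obtain ⟨j, -, rfl⟩ := Multiset.mem_map.1 hi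
    exact dvd_mul_right m j
  · ext1
    simp [splitParts, hs, Multiset.map_map, Nat.mul_div_cancel_left _ hm]

end Nat.Partition


/-- For a positive integer `n` and an integer `m ≥ 2`, the number of partitions of `n` in
which every part is a multiple of `m` equals the number of partitions of `n` in which the
multiplicity of every part is a multiple of `m`. -/
theorem stmt_19 (n : ℕ) (hn : 0 < n) (m : ℕ) (hm : 2 ≤ m) :
    Nat.card {p : Nat.Partition n // ∀ i ∈ p.parts, m ∣ i}
      = Nat.card {p : Nat.Partition n // ∀ i ∈ p.parts, m ∣ p.parts.count i} := by
  have hm0 : 0 < m := by omega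
  refine Nat.card_eq_of_bijective
    (fun p => ⟨p.1.splitParts hm0 p.2, fun i _ => p.1.dvd_count_splitParts hm0 p.2 i⟩) ⟨?_, ?_⟩
  · intro p q h
    exact Subtype.ext (Nat.Partition.eq_of_splitParts_eq hm0 p.2 q.2 (congrArg Subtype.val h))
  · rintro ⟨q, hq⟩
    obtain ⟨p, hp, hpq⟩ := q.exists_splitParts_eq hm0 hq
    exact ⟨⟨p, hp⟩, Subtype.ext hpq⟩
end
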